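/- arXiv:1402.5052 — 4 statements merged into one kernel-verified Lean document; each statement's English description precedes it below -/
import Mathlib

section
/- (1) Suppose X is a local minimizer of the KS minimization problem and ε_xc is twice differentiable at ρ(X). Then with Λ := XᵀH(X)X, for every S ∈ ℝ^{n×p} with XᵀS + SᵀX = 0 one has tr(SᵀH(X)S − Λ SᵀS) + 2 diag(XSᵀ)ᵀ J(ρ(X)) diag(XSᵀ) ≥ 0. (2) Conversely, suppose X ∈ ℝ^{n×p} satisfies XᵀX = I and H(X)X = XΛ with Λ = XᵀH(X)X symmetric, and the above inequality holds strictly for every nonzero S with XᵀS + SᵀX = 0. Then X is a strict local minimizer of the KS minimization problem. -/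
open Matrix Filter

/-- Charge density `ρ(X) = diag(XXᵀ)`. -/
noncomputable def rhoX {n p : ℕ} (X : Matrix (Fin n) (Fin p) ℝ) : Fin n → ℝ :=
  fun i => (X * Xᵀ) i i

/-- `μ_xc(ρ)ᵀe`, the gradient of `ρ ↦ eᵀ ε_xc(ρ)`. -/
noncomputable def muE {n : ℕ} (εxc : (Fin n → ℝ) → (Fin n → ℝ)) (ρ : Fin n → ℝ) :
    Fin n → ℝ :=
  fun i => fderiv ℝ (fun r => ∑ j, εxc r j) ρ (Pi.single i 1)

/-- KS total energy
`E(X) = (1/4)tr(XᵀLX) + (1/2)tr(XᵀV_ion X) + (1/4)ρᵀL†ρ + (1/2)eᵀε_xc(ρ)`. -/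
noncomputable def EKS {n p : ℕ} (L Vion Ld : Matrix (Fin n) (Fin n) ℝ)
    (εxc : (Fin n → ℝ) → (Fin n → ℝ)) (X : Matrix (Fin n) (Fin p) ℝ) : ℝ :=
  (1 / 4) * Matrix.trace (Xᵀ * L * X) + (1 / 2) * Matrix.trace (Xᵀ * Vion * X)
    + (1 / 4) * (rhoX X ⬝ᵥ Ld.mulVec (rhoX X)) + (1 / 2) * ∑ i, εxc (rhoX X) i

/-- KS Hamiltonian `H(X) = (1/2)L + V_ion + Diag(L†ρ) + Diag(μ_xc(ρ)ᵀe)`. -/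
noncomputable def HKS {n p : ℕ} (L Vion Ld : Matrix (Fin n) (Fin n) ℝ)
    (εxc : (Fin n → ℝ) → (Fin n → ℝ)) (X : Matrix (Fin n) (Fin p) ℝ) :
    Matrix (Fin n) (Fin n) ℝ :=
  (1 / 2 : ℝ) • L + Vion + Matrix.diagonal (Ld.mulVec (rhoX X))
    + Matrix.diagonal (muE εxc (rhoX X))

/-- `J(ρ) = L† + ∂(μ_xc(ρ)ᵀe)/∂ρ`. -/
noncomputable def JKS {n : ℕ} (Ld : Matrix (Fin n) (Fin n) ℝ)
    (εxc : (Fin n → ℝ) → (Fin n → ℝ)) (ρ : Fin n → ℝ) : Matrix (Fin n) (Fin n) ℝ :=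
  Matrix.of fun i j => Ld i j + fderiv ℝ (fun r => muE εxc r j) ρ (Pi.single i 1)

/-- `diag(XSᵀ)`. -/
noncomputable def dvec {n p : ℕ} (X S : Matrix (Fin n) (Fin p) ℝ) : Fin n → ℝ :=
  fun i => (X * Sᵀ) i i

open scoped Topology

/-- Second-order Taylor expansion with Peano remainder. -/
theorem ContDiffAt.taylor_two_isLittleO {E : Type*} [NormedAddCommGroup E] [NormedSpace ℝ E]
    {f : E → ℝ} {x : E} (hf : ContDiffAt ℝ 2 f x) :
    (fun y => f y - f x - fderiv ℝ f x (y - x)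
        - (1 / 2) * fderiv ℝ (fderiv ℝ f) x (y - x) (y - x))
      =o[𝓝 x] fun y => ‖y - x‖ ^ 2 := by
  set B := fderiv ℝ (fderiv ℝ f) x with hB
  have hsymm : ∀ v w, B v w = B w v := hf.isSymmSndFDerivAt (by simp)
  have hd : ∀ᶠ y in 𝓝 x, DifferentiableAt ℝ f y :=
    (hf.eventually (by simp)).mono fun y hy => hy.differentiableAt (by simp)
  have hB' : HasFDerivAt (fderiv ℝ f) B x :=
    ((hf.fderiv_right (m := 1) (by norm_num)).differentiableAt (by simp)).hasFDerivAt
  obtain ⟨r, hr, hball⟩ := Metric.eventually_nhds_iff_ball.1 hd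
  have key := (convex_ball x r).isLittleO_pow_succ (n := 1) (x₀ := x)
    (f := fun y => f y - fderiv ℝ f x (y - x) - (1 / 2) * B (y - x) (y - x))
    (f' := fun y => fderiv ℝ f y - fderiv ℝ f x - B (y - x))
    (Metric.mem_ball_self hr) ?_ ?_
  · rw [nhdsWithin_eq_nhds.2 (Metric.ball_mem_nhds x hr)] at key
    refine key.congr_left fun y => ?_
    simp
    ring
  · intro y hy
    have h1 : HasFDerivAt (fun y : E => y - x) (ContinuousLinearMap.id ℝ E) y :=
      (hasFDerivAt_id y).sub_const x
    have h2 := (B.hasFDerivAt.comp y h1).clm_apply h1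
    have h3 := (((hball y hy).hasFDerivAt.sub ((fderiv ℝ f x).hasFDerivAt.comp y h1)).sub
      (h2.const_mul (1 / 2)))
    refine (h3.congr_fderiv ?_).hasFDerivWithinAt
    ext v
    have := hsymm v (y - x)
    simp only [map_sub, FunLike.coe_sub, Pi.sub_apply] at this
    simp
    linarith
  · rw [nhdsWithin_eq_nhds.2 (Metric.ball_mem_nhds x hr)]
    simpa using hB'.isLittleO.norm_right

theorem ContDiffAt.tendsto_taylor_two {E ι : Type*} [NormedAddCommGroup E] [NormedSpace ℝ E]
    {f : E → ℝ} {x : E} (hf : ContDiffAt ℝ 2 f x) {l : Filter ι} {c : ι → ℝ} {v : ι → E} {w : E}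
    (hc : Tendsto c l (𝓝 0)) (hc0 : ∀ᶠ i in l, c i ≠ 0) (hv : Tendsto v l (𝓝 w)) :
    Tendsto (fun i => (f (x + c i • v i) - f x - c i * fderiv ℝ f x (v i)) / c i ^ 2) l
      (𝓝 ((1 / 2) * fderiv ℝ (fderiv ℝ f) x w w)) := by
  have hx : Tendsto (fun i => x + c i • v i) l (𝓝 x) := by
    simpa using tendsto_const_nhds.add (hc.smul hv)
  have hO : (fun i => ‖x + c i • v i - x‖ ^ 2) =O[l] fun i => c i ^ 2 := by
    refine Asymptotics.IsBigO.pow ?_ 2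
    simpa using ((Asymptotics.isBigO_refl c l).smul (hv.isBigO_one ℝ)).norm_left
  have h0 := ((hf.taylor_two_isLittleO.comp_tendsto hx).trans_isBigO hO).tendsto_div_nhds_zero
  have hB : Tendsto (fun i => (1 / 2) * fderiv ℝ (fderiv ℝ f) x (v i) (v i)) l
      (𝓝 ((1 / 2) * fderiv ℝ (fderiv ℝ f) x w w)) :=
    Tendsto.const_mul _
      (((fderiv ℝ (fderiv ℝ f) x).continuous₂.tendsto (w, w)).comp (hv.prodMk_nhds hv))
  have := h0.add hB
  rw [zero_add] at this
  refine this.congr' ?_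
  filter_upwards [hc0] with i hi
  simp only [Function.comp_apply, add_sub_cancel_left, map_smul, smul_eq_mul,
    FunLike.coe_smul, Pi.smul_apply]
  field_simp
  ring

open NormedSpace in
theorem tendsto_exp_smul_mul_sub_div {n p : ℕ} (W : Matrix (Fin n) (Fin n) ℝ)
    (X : Matrix (Fin n) (Fin p) ℝ) :
    Tendsto (fun t : ℝ => t⁻¹ • (exp (t • W) * X - X)) (𝓝[>] 0) (𝓝 (W * X)) := by
  open scoped Matrix.Norms.Operator in
  have h := (hasDerivAt_exp_smul_const (𝕂 := ℝ) W 0).tendsto_slope_zero_right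
  simp only [zero_add, zero_smul, exp_zero, one_mul] at h
  have h2 := (((continuous_id.matrix_mul continuous_const).tendsto W).comp h :
    Tendsto _ _ (𝓝 (W * X)))
  refine h2.congr fun t => ?_
  simp [Matrix.sub_mul]
  rfl

/-- Every tangent vector `S` of the Stiefel manifold at `X` is the velocity at `0` of a curve
`t ↦ X + t • T t` in the manifold. -/
theorem exists_stiefel_curve {n p : ℕ} {X S : Matrix (Fin n) (Fin p) ℝ} (hX : Xᵀ * X = 1)
    (hS : Xᵀ * S + Sᵀ * X = 0) :
    ∃ T : ℝ → Matrix (Fin n) (Fin p) ℝ, Tendsto T (𝓝[>] 0) (𝓝 S) ∧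
      ∀ t, t ≠ 0 → (X + t • T t)ᵀ * (X + t • T t) = 1 := by
  have hSX : Sᵀ * X = -(Xᵀ * S) := eq_neg_of_add_eq_zero_right hS
  set W : Matrix (Fin n) (Fin n) ℝ := S * Xᵀ - X * Sᵀ
    - (1 / 2 : ℝ) • (X * (Xᵀ * S) * Xᵀ - X * (Sᵀ * X) * Xᵀ) with hW
  have hWt : Wᵀ = -W := by
    simp [hW, Matrix.mul_assoc]
    module
  have hWX : W * X = S := by
    simp [hW, Matrix.sub_mul, Matrix.mul_assoc, hX, hSX, Matrix.add_mul, Matrix.smul_mul]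
    module
  refine ⟨fun t => t⁻¹ • (NormedSpace.exp (t • W) * X - X), ?_, fun t ht => ?_⟩
  · simpa [hWX] using tendsto_exp_smul_mul_sub_div W X
  · have hE : (NormedSpace.exp (t • W))ᵀ * NormedSpace.exp (t • W) = 1 := by
      rw [← Matrix.exp_transpose, transpose_smul, hWt, smul_neg, Matrix.exp_neg]
      exact Matrix.nonsing_inv_mul _ ((Matrix.isUnit_iff_isUnit_det _).1 (Matrix.isUnit_exp _))
    rw [smul_inv_smul₀ ht, add_sub_cancel, transpose_mul, Matrix.mul_assoc,
      ← Matrix.mul_assoc _ _ X, hE, Matrix.one_mul, hX]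

/-- The Moore–Penrose pseudoinverse of a symmetric matrix is symmetric. -/
theorem Matrix.transpose_eq_self_of_penrose {n : Type*} [Fintype n] {L B : Matrix n n ℝ}
    (hL : Lᵀ = L) (h1 : L * B * L = L) (h2 : B * L * B = B)
    (h3 : (L * B)ᵀ = L * B) (h4 : (B * L)ᵀ = B * L) : Bᵀ = B := by
  rw [transpose_mul, hL] at h3 h4
  have h5 : Bᵀ * L * Bᵀ = Bᵀ := by
    simpa [hL, Matrix.mul_assoc] using congrArg transpose h2
  have hBL : B * L = Bᵀ * L := by
    calc B * L = L * Bᵀ := h4.symm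
      _ = (L * B * L) * Bᵀ := by rw [h1]
      _ = (L * B) * (L * Bᵀ) := by simp only [Matrix.mul_assoc]
      _ = (L * B) * (B * L) := by rw [h4]
      _ = (Bᵀ * L) * (B * L) := by rw [h3]
      _ = Bᵀ * (L * B * L) := by simp only [Matrix.mul_assoc]
      _ = Bᵀ * L := by rw [h1]
  calc Bᵀ = Bᵀ * L * Bᵀ := h5.symm
    _ = Bᵀ * (L * Bᵀ) := Matrix.mul_assoc _ _ _
    _ = Bᵀ * (B * L) := by rw [h4]
    _ = Bᵀ * (L * B) := by rw [hBL, h3]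
    _ = B * L * B := by rw [← Matrix.mul_assoc, hBL]
    _ = B := h2

theorem trace_transpose_mul_diagonal_mul {n p : ℕ} (d : Fin n → ℝ)
    (X T : Matrix (Fin n) (Fin p) ℝ) :
    trace (Tᵀ * diagonal d * X) = d ⬝ᵥ dvec X T := by
  rw [Matrix.mul_assoc, Matrix.trace_mul_comm, Matrix.mul_assoc]
  simp [trace, diagonal_mul, dotProduct, dvec]

theorem dvec_self {n p : ℕ} (X : Matrix (Fin n) (Fin p) ℝ) : dvec X X = rhoX X := rfl

theorem trace_quadratic_add_smul {n p : ℕ} {A : Matrix (Fin n) (Fin n) ℝ} (hA : Aᵀ = A)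
    (X T : Matrix (Fin n) (Fin p) ℝ) (c : ℝ) :
    trace ((X + c • T)ᵀ * A * (X + c • T)) =
      trace (Xᵀ * A * X) + 2 * c * trace (Tᵀ * A * X) + c ^ 2 * trace (Tᵀ * A * T) := by
  have h : trace (Xᵀ * A * T) = trace (Tᵀ * A * X) := by
    rw [← trace_transpose]
    simp [hA, Matrix.mul_assoc]
  simp [Matrix.add_mul, Matrix.mul_add, h]
  ring

theorem dotProduct_mulVec_add_smul {n : ℕ} {A : Matrix (Fin n) (Fin n) ℝ} (hA : Aᵀ = A)
    (r v : Fin n → ℝ) (c : ℝ) :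
    (r + c • v) ⬝ᵥ A.mulVec (r + c • v) =
      r ⬝ᵥ A.mulVec r + 2 * c * (A.mulVec r ⬝ᵥ v) + c ^ 2 * (v ⬝ᵥ A.mulVec v) := by
  have h : r ⬝ᵥ A.mulVec v = A.mulVec r ⬝ᵥ v := by
    rw [dotProduct_mulVec, ← mulVec_transpose, hA]
  have h' : v ⬝ᵥ A.mulVec r = A.mulVec r ⬝ᵥ v := dotProduct_comm _ _
  simp [mulVec_add, mulVec_smul, h, h']
  ring

theorem rhoX_add_smul {n p : ℕ} (X T : Matrix (Fin n) (Fin p) ℝ) (c : ℝ) :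
    rhoX (X + c • T) = rhoX X + c • ((2 : ℝ) • dvec X T + c • rhoX T) := by
  ext i
  have h : (T * Xᵀ) i i = (X * Tᵀ) i i := by
    rw [← transpose_apply (X * Tᵀ), transpose_mul, transpose_transpose]
  simp [rhoX, dvec, Matrix.add_mul, Matrix.mul_add, h]
  ring

theorem muE_dotProduct {n : ℕ} (εxc : (Fin n → ℝ) → (Fin n → ℝ)) (r v : Fin n → ℝ) :
    muE εxc r ⬝ᵥ v = fderiv ℝ (fun r => ∑ j, εxc r j) r v := by
  conv_rhs => rw [pi_eq_sum_univ' v]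
  simp [muE, dotProduct, mul_comm]

theorem HKS_transpose {n p : ℕ} {L Vion : Matrix (Fin n) (Fin n) ℝ} (hL : Lᵀ = L)
    (hV : Vionᵀ = Vion) (Ld : Matrix (Fin n) (Fin n) ℝ) (εxc : (Fin n → ℝ) → (Fin n → ℝ))
    (X : Matrix (Fin n) (Fin p) ℝ) :
    (HKS L Vion Ld εxc X)ᵀ = HKS L Vion Ld εxc X := by
  simp [HKS, hL, hV]

theorem dotProduct_JKS_mulVec {n : ℕ} (Ld : Matrix (Fin n) (Fin n) ℝ)
    {εxc : (Fin n → ℝ) → (Fin n → ℝ)} {r : Fin n → ℝ}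
    (hε : ContDiffAt ℝ 2 (fun r => ∑ j, εxc r j) r) (d : Fin n → ℝ) :
    d ⬝ᵥ (JKS Ld εxc r).mulVec d = d ⬝ᵥ Ld.mulVec d
      + fderiv ℝ (fderiv ℝ (fun r => ∑ j, εxc r j)) r d d := by
  set f := fun r => ∑ j, εxc r j with hf
  have hB : HasFDerivAt (fderiv ℝ f) (fderiv ℝ (fderiv ℝ f) r) r :=
    ((hε.fderiv_right (m := 1) (by norm_num)).differentiableAt (by simp)).hasFDerivAt
  have hμ : ∀ i j, fderiv ℝ (fun r => muE εxc r j) r (Pi.single i 1)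
      = fderiv ℝ (fderiv ℝ f) r (Pi.single i 1) (Pi.single j 1) := fun i j => by
    have h : HasFDerivAt (fun r => muE εxc r j) _ r :=
      hB.clm_apply (hasFDerivAt_const (Pi.single j (1 : ℝ) : Fin n → ℝ) r)
    rw [h.fderiv]
    simp
  have hJ : JKS Ld εxc r = Ld
      + of fun i j => fderiv ℝ (fderiv ℝ f) r (Pi.single i 1) (Pi.single j 1) := by
    ext i j
    simp [JKS, hμ]
  rw [hJ, add_mulVec, dotProduct_add]
  congr 1
  conv_rhs => rw [pi_eq_sum_univ' d]
  simp [dotProduct, mulVec, Finset.mul_sum]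
  rw [Finset.sum_comm]
  refine Finset.sum_congr rfl fun i _ => Finset.sum_congr rfl fun j _ => ?_
  ring

/-- Second-order Taylor expansion of the energy along `X + c i • T i` as `c i → 0`, `T i → S`. -/
theorem tendsto_EKS_taylor_two {n p : ℕ} {ι : Type*} {L Vion Ld : Matrix (Fin n) (Fin n) ℝ}
    (hL : Lᵀ = L) (hV : Vionᵀ = Vion) (hLd : Ldᵀ = Ld) {εxc : (Fin n → ℝ) → (Fin n → ℝ)}
    {X : Matrix (Fin n) (Fin p) ℝ} (hε : ContDiffAt ℝ 2 εxc (rhoX X)) {l : Filter ι} {c : ι → ℝ}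
    {T : ι → Matrix (Fin n) (Fin p) ℝ} {S : Matrix (Fin n) (Fin p) ℝ}
    (hc : Tendsto c l (𝓝 0)) (hc0 : ∀ᶠ i in l, c i ≠ 0) (hT : Tendsto T l (𝓝 S)) :
    Tendsto (fun i => (EKS L Vion Ld εxc (X + c i • T i) - EKS L Vion Ld εxc X
        - c i * trace ((T i)ᵀ * HKS L Vion Ld εxc X * X)) / c i ^ 2) l
      (𝓝 ((1 / 2) * (trace (Sᵀ * HKS L Vion Ld εxc X * S)
        + 2 * (dvec X S ⬝ᵥ (JKS Ld εxc (rhoX X)).mulVec (dvec X S))))) := by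
  set f := fun r => ∑ j, εxc r j with hf
  have hfC : ContDiffAt ℝ 2 f (rhoX X) :=
    ContDiffAt.sum fun j _ => contDiffAt_pi.1 hε j
  set H := HKS L Vion Ld εxc X with hH
  set v : ι → Fin n → ℝ := fun i => (2 : ℝ) • dvec X (T i) + c i • rhoX (T i) with hv
  have hdc : Continuous fun T : Matrix (Fin n) (Fin p) ℝ => dvec X T := by
    unfold dvec; fun_prop
  have hrc : Continuous fun T : Matrix (Fin n) (Fin p) ℝ => rhoX T := by
    unfold rhoX; fun_prop
  have hvlim : Tendsto v l (𝓝 ((2 : ℝ) • dvec X S)) := by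
    simpa using (((hdc.tendsto S).comp hT).const_smul (2 : ℝ)).add
      (hc.smul ((hrc.tendsto S).comp hT))
  have hq : Continuous fun T : Matrix (Fin n) (Fin p) ℝ => trace (Tᵀ * H * T) := by fun_prop
  have hqd : Continuous fun d : Fin n → ℝ => d ⬝ᵥ Ld.mulVec d := by fun_prop
  have hlim := ((((hq.tendsto S).comp hT).const_mul (1 / 2)).add
    (((hqd.tendsto _).comp hvlim).const_mul (1 / 4))).add
    ((hfC.tendsto_taylor_two hc hc0 hvlim).const_mul (1 / 2))
  have hval : (1 / 2) * (trace (Sᵀ * H * S)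
        + 2 * (dvec X S ⬝ᵥ (JKS Ld εxc (rhoX X)).mulVec (dvec X S)))
      = 1 / 2 * trace (Sᵀ * H * S)
        + 1 / 4 * (((2 : ℝ) • dvec X S) ⬝ᵥ Ld.mulVec ((2 : ℝ) • dvec X S))
        + 1 / 2 * (1 / 2 * fderiv ℝ (fderiv ℝ f) (rhoX X) ((2 : ℝ) • dvec X S)
          ((2 : ℝ) • dvec X S)) := by
    rw [dotProduct_JKS_mulVec Ld hfC]
    simp [mulVec_smul]
    ring
  rw [hval]
  refine hlim.congr' ?_
  filter_upwards [hc0] with i hi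
  have hHtr : ∀ U : Matrix (Fin n) (Fin p) ℝ, trace ((T i)ᵀ * H * U) =
      (1 / 2) * trace ((T i)ᵀ * L * U) + trace ((T i)ᵀ * Vion * U)
        + Ld.mulVec (rhoX X) ⬝ᵥ dvec U (T i) + muE εxc (rhoX X) ⬝ᵥ dvec U (T i) := fun U => by
    simp [hH, HKS, Matrix.mul_add, Matrix.add_mul, trace_transpose_mul_diagonal_mul]
  have hρ : rhoX (X + c i • T i) = rhoX X + c i • v i := rhoX_add_smul X (T i) (c i)
  have hE : EKS L Vion Ld εxc (X + c i • T i) - EKS L Vion Ld εxc X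
      = (1 / 2) * c i * trace ((T i)ᵀ * L * X) + (1 / 4) * c i ^ 2 * trace ((T i)ᵀ * L * T i)
        + (c i * trace ((T i)ᵀ * Vion * X) + (1 / 2) * c i ^ 2 * trace ((T i)ᵀ * Vion * T i))
        + ((1 / 2) * c i * (Ld.mulVec (rhoX X) ⬝ᵥ v i)
          + (1 / 4) * c i ^ 2 * (v i ⬝ᵥ Ld.mulVec (v i)))
        + (1 / 2) * (f (rhoX X + c i • v i) - f (rhoX X)) := by
    simp only [EKS, hρ, trace_quadratic_add_smul hL, trace_quadratic_add_smul hV,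
      dotProduct_mulVec_add_smul hLd, hf]
    ring
  have hdot : ∀ g : Fin n → ℝ,
      g ⬝ᵥ v i = 2 * (g ⬝ᵥ dvec X (T i)) + c i * (g ⬝ᵥ dvec (T i) (T i)) := fun g => by
    simp [hv, dvec_self]
  rw [hE, hHtr X, ← muE_dotProduct, hdot]
  simp only [Function.comp_apply, hHtr, hdot]
  field_simp
  ring

theorem tendsto_id_nhdsGT_zero : Tendsto (fun t : ℝ => t) (𝓝[>] 0) (𝓝 0) := nhdsWithin_le_nhds

theorem eventually_nhdsGT_ne_zero : ∀ᶠ t : ℝ in 𝓝[>] 0, t ≠ 0 :=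
  eventually_mem_nhdsWithin.mono fun _ ht => ne_of_gt ht

theorem exists_stiefel_curve_EKS_le {n p : ℕ} {L Vion Ld : Matrix (Fin n) (Fin n) ℝ}
    {εxc : (Fin n → ℝ) → (Fin n → ℝ)} {X S : Matrix (Fin n) (Fin p) ℝ} (hX : Xᵀ * X = 1)
    (hmin : IsLocalMinOn (EKS L Vion Ld εxc) {Y : Matrix (Fin n) (Fin p) ℝ | Yᵀ * Y = 1} X)
    (hS : Xᵀ * S + Sᵀ * X = 0) :
    ∃ T : ℝ → Matrix (Fin n) (Fin p) ℝ, Tendsto T (𝓝[>] 0) (𝓝 S) ∧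
      (∀ᶠ t in 𝓝[>] 0, (X + t • T t)ᵀ * (X + t • T t) = 1) ∧
      ∀ᶠ t in 𝓝[>] 0, EKS L Vion Ld εxc X ≤ EKS L Vion Ld εxc (X + t • T t) := by
  obtain ⟨T, hT, hM⟩ := exists_stiefel_curve hX hS
  have hM' : ∀ᶠ t in 𝓝[>] 0, (X + t • T t)ᵀ * (X + t • T t) = 1 := eventually_nhdsGT_ne_zero.mono hM
  have hlim : Tendsto (fun t => X + t • T t) (𝓝[>] 0) (𝓝 X) := by
    simpa using tendsto_const_nhds.add (tendsto_id_nhdsGT_zero.smul hT)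
  exact ⟨T, hT, hM', (tendsto_nhdsWithin_iff.2 ⟨hlim, hM'⟩).eventually hmin⟩

theorem transpose_mul_add_eq_zero_of_tendsto {n p : ℕ} {ι : Type*} {l : Filter ι} [l.NeBot]
    {X : Matrix (Fin n) (Fin p) ℝ} (hX : Xᵀ * X = 1) {c : ι → ℝ}
    {T : ι → Matrix (Fin n) (Fin p) ℝ} {S : Matrix (Fin n) (Fin p) ℝ}
    (hc : Tendsto c l (𝓝 0)) (hc0 : ∀ᶠ i in l, c i ≠ 0) (hT : Tendsto T l (𝓝 S))
    (hM : ∀ᶠ i in l, (X + c i • T i)ᵀ * (X + c i • T i) = 1) :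
    Xᵀ * S + Sᵀ * X = 0 := by
  have h1 : Continuous fun T : Matrix (Fin n) (Fin p) ℝ => Xᵀ * T + Tᵀ * X := by fun_prop
  have h2 : Continuous fun T : Matrix (Fin n) (Fin p) ℝ => Tᵀ * T := by fun_prop
  have h3 := ((h1.tendsto S).comp hT).add (hc.smul ((h2.tendsto S).comp hT))
  rw [zero_smul, add_zero] at h3
  refine tendsto_nhds_unique (h3.congr' ?_) (tendsto_const_nhds (x := 0))
  filter_upwards [hc0, hM] with i hi hMi
  refine (smul_eq_zero.1 ?_).resolve_left hi
  simp only [transpose_add, transpose_smul, Matrix.add_mul, Matrix.mul_add, hX,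
    Matrix.smul_mul, Matrix.mul_smul] at hMi
  rw [← sub_eq_zero] at hMi
  simp only [Function.comp_apply]
  rw [← hMi]
  module

theorem tendsto_EKS_sub_div_sq_of_stiefel {n p : ℕ} {ι : Type*}
    {L Vion Ld : Matrix (Fin n) (Fin n) ℝ}
    (hL : Lᵀ = L) (hV : Vionᵀ = Vion) (hLd : Ldᵀ = Ld) {εxc : (Fin n → ℝ) → (Fin n → ℝ)}
    {X : Matrix (Fin n) (Fin p) ℝ} (hε : ContDiffAt ℝ 2 εxc (rhoX X)) (hX : Xᵀ * X = 1)
    {Λ : Matrix (Fin p) (Fin p) ℝ} (hΛ : HKS L Vion Ld εxc X * X = X * Λ) (hΛt : Λᵀ = Λ)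
    {l : Filter ι} {c : ι → ℝ}
    {T : ι → Matrix (Fin n) (Fin p) ℝ} {S : Matrix (Fin n) (Fin p) ℝ}
    (hc : Tendsto c l (𝓝 0)) (hc0 : ∀ᶠ i in l, c i ≠ 0) (hT : Tendsto T l (𝓝 S))
    (hM : ∀ᶠ i in l, (X + c i • T i)ᵀ * (X + c i • T i) = 1) :
    Tendsto (fun i => (EKS L Vion Ld εxc (X + c i • T i) - EKS L Vion Ld εxc X) / c i ^ 2) l
      (𝓝 ((1 / 2) * (trace (Sᵀ * HKS L Vion Ld εxc X * S - Λ * (Sᵀ * S))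
        + 2 * (dvec X S ⬝ᵥ (JKS Ld εxc (rhoX X)).mulVec (dvec X S))))) := by
  have h1 := tendsto_EKS_taylor_two hL hV hLd hε hc hc0 hT
  have hq : Continuous fun T : Matrix (Fin n) (Fin p) ℝ => trace (Λ * (Tᵀ * T)) := by fun_prop
  have h2 := h1.sub (((hq.tendsto S).comp hT).const_mul (1 / 2))
  have hval : (1 / 2) * (trace (Sᵀ * HKS L Vion Ld εxc X * S - Λ * (Sᵀ * S))
        + 2 * (dvec X S ⬝ᵥ (JKS Ld εxc (rhoX X)).mulVec (dvec X S)))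
      = (1 / 2) * (trace (Sᵀ * HKS L Vion Ld εxc X * S)
        + 2 * (dvec X S ⬝ᵥ (JKS Ld εxc (rhoX X)).mulVec (dvec X S)))
        - 1 / 2 * trace (Λ * (Sᵀ * S)) := by
    rw [trace_sub]
    ring
  rw [hval]
  refine h2.congr' ?_
  filter_upwards [hc0, hM] with i hi hMi
  have hcon : c i * (2 * trace (Λ * ((T i)ᵀ * X)) + c i * trace (Λ * ((T i)ᵀ * T i))) = 0 := by
    have h := congrArg (fun Z => trace (Λ * Z)) hMi
    have hsw : trace (Λ * (Xᵀ * T i)) = trace (Λ * ((T i)ᵀ * X)) := by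
      rw [← trace_transpose, trace_mul_comm]
      simp [hΛt, Matrix.mul_assoc]
    simp [Matrix.add_mul, Matrix.mul_add, hX, hsw] at h
    linear_combination h
  have hcon' := (mul_eq_zero.1 hcon).resolve_left hi
  have hH : trace ((T i)ᵀ * HKS L Vion Ld εxc X * X) = trace (Λ * ((T i)ᵀ * X)) := by
    rw [Matrix.mul_assoc, hΛ, ← Matrix.mul_assoc, trace_mul_comm]
  simp only [Function.comp_apply]
  rw [hH]
  field_simp
  linear_combination (-c i) * hcon'

theorem trace_transpose_mul_HKS_mul_nonneg {n p : ℕ} {L Vion Ld : Matrix (Fin n) (Fin n) ℝ}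
    (hL : Lᵀ = L) (hV : Vionᵀ = Vion) (hLd : Ldᵀ = Ld) {εxc : (Fin n → ℝ) → (Fin n → ℝ)}
    {X : Matrix (Fin n) (Fin p) ℝ} (hε : ContDiffAt ℝ 2 εxc (rhoX X)) (hX : Xᵀ * X = 1)
    (hmin : IsLocalMinOn (EKS L Vion Ld εxc) {Y : Matrix (Fin n) (Fin p) ℝ | Yᵀ * Y = 1} X)
    {S : Matrix (Fin n) (Fin p) ℝ} (hS : Xᵀ * S + Sᵀ * X = 0) :
    0 ≤ trace (Sᵀ * HKS L Vion Ld εxc X * X) := by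
  obtain ⟨T, hT, hM, hE⟩ := exists_stiefel_curve_EKS_le hX hmin hS
  have h0 := tendsto_id_nhdsGT_zero
  have h1 := tendsto_EKS_taylor_two hL hV hLd hε h0 eventually_nhdsGT_ne_zero hT
  have hq : Continuous fun T : Matrix (Fin n) (Fin p) ℝ =>
    trace (Tᵀ * HKS L Vion Ld εxc X * X) := by fun_prop
  have h2 := (h0.mul h1).add ((hq.tendsto S).comp hT)
  rw [zero_mul, zero_add] at h2
  refine ge_of_tendsto h2 ?_
  filter_upwards [hE, self_mem_nhdsWithin] with t ht htpos
  have htpos : 0 < t := htpos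
  have : t * ((EKS L Vion Ld εxc (X + t • T t) - EKS L Vion Ld εxc X
      - t * trace ((T t)ᵀ * HKS L Vion Ld εxc X * X)) / t ^ 2)
      + trace ((T t)ᵀ * HKS L Vion Ld εxc X * X)
      = (EKS L Vion Ld εxc (X + t • T t) - EKS L Vion Ld εxc X) / t := by
    field_simp
    ring
  simp only [Function.comp_apply]
  rw [this]
  exact div_nonneg (sub_nonneg.2 ht) htpos.le

/-- First-order optimality condition `H(X)X = XΛ` at a local minimizer. -/
theorem HKS_mul_eq_of_isLocalMinOn {n p : ℕ} {L Vion Ld : Matrix (Fin n) (Fin n) ℝ}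
    (hL : Lᵀ = L) (hV : Vionᵀ = Vion) (hLd : Ldᵀ = Ld) {εxc : (Fin n → ℝ) → (Fin n → ℝ)}
    {X : Matrix (Fin n) (Fin p) ℝ} (hε : ContDiffAt ℝ 2 εxc (rhoX X)) (hX : Xᵀ * X = 1)
    (hmin : IsLocalMinOn (EKS L Vion Ld εxc) {Y : Matrix (Fin n) (Fin p) ℝ | Yᵀ * Y = 1} X) :
    HKS L Vion Ld εxc X * X = X * (Xᵀ * HKS L Vion Ld εxc X * X) := by
  set G := HKS L Vion Ld εxc X * X with hG
  set R := G - X * (Xᵀ * G) with hR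
  have hXR : Xᵀ * R = 0 := by
    rw [hR, Matrix.mul_sub, ← Matrix.mul_assoc Xᵀ X, hX, Matrix.one_mul, sub_self]
  have hRX : Rᵀ * X = 0 := by simpa using congrArg transpose hXR
  have h := trace_transpose_mul_HKS_mul_nonneg hL hV hLd hε hX hmin (S := -R)
    (by simp [hXR, hRX])
  have hRG : Rᵀ * G = Rᵀ * R := by
    have : Rᵀ * (X * (Xᵀ * G)) = 0 := by rw [← Matrix.mul_assoc, hRX, Matrix.zero_mul]
    rw [← sub_zero (Rᵀ * G), ← this, ← Matrix.mul_sub]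
  rw [Matrix.mul_assoc, ← hG, transpose_neg, Matrix.neg_mul, hRG, trace_neg] at h
  have hnn : 0 ≤ trace (Rᵀ * R) := by
    simpa using (posSemidef_conjTranspose_mul_self R).trace_nonneg
  have hR0 : R = 0 := by
    rw [← trace_conjTranspose_mul_self_eq_zero_iff, conjTranspose_eq_transpose_of_trivial]
    linarith
  rw [Matrix.mul_assoc Xᵀ, ← hG]
  exact sub_eq_zero.1 hR0

open scoped Matrix.Norms.Elementwise in
/-- If `P` holds frequently near `X` on the Stiefel manifold minus `X`, then the directions from `X`
to points satisfying `P` have a nonzero limit along some ultrafilter. -/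
theorem exists_ultrafilter_tendsto_direction {n p : ℕ} {X : Matrix (Fin n) (Fin p) ℝ}
    {P : Matrix (Fin n) (Fin p) ℝ → Prop}
    (h : ∃ᶠ Y in 𝓝[{Y : Matrix (Fin n) (Fin p) ℝ | Yᵀ * Y = 1} \ {X}] X, P Y) :
    ∃ (u : Ultrafilter (Matrix (Fin n) (Fin p) ℝ)) (c : Matrix (Fin n) (Fin p) ℝ → ℝ)
      (S : Matrix (Fin n) (Fin p) ℝ), S ≠ 0 ∧ Tendsto c u (𝓝 0) ∧
      (∀ᶠ Y in (u : Filter (Matrix (Fin n) (Fin p) ℝ)), c Y ≠ 0) ∧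
      Tendsto (fun Y => (c Y)⁻¹ • (Y - X)) u (𝓝 S) ∧
      (∀ᶠ Y in (u : Filter (Matrix (Fin n) (Fin p) ℝ)), Yᵀ * Y = 1) ∧
      ∀ᶠ Y in (u : Filter (Matrix (Fin n) (Fin p) ℝ)), P Y := by
  have := frequently_mem_iff_neBot (s := {Y | P Y}).1 h
  obtain ⟨u, hle⟩ := Ultrafilter.exists_le
    (𝓝[{Y : Matrix (Fin n) (Fin p) ℝ | Yᵀ * Y = 1} \ {X}] X ⊓ 𝓟 {Y | P Y})
  have hmem : ∀ᶠ Y in (u : Filter (Matrix (Fin n) (Fin p) ℝ)),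
      Y ∈ {Y : Matrix (Fin n) (Fin p) ℝ | Yᵀ * Y = 1} \ {X} :=
    hle (mem_inf_of_left self_mem_nhdsWithin)
  have hne : ∀ᶠ Y in (u : Filter (Matrix (Fin n) (Fin p) ℝ)), ‖Y - X‖ ≠ 0 :=
    hmem.mono fun Y hY => norm_ne_zero_iff.2 (sub_ne_zero.2 hY.2)
  have hlim : Tendsto (fun Y => Y) (u : Filter (Matrix (Fin n) (Fin p) ℝ)) (𝓝 X) :=
    hle.trans (inf_le_left.trans nhdsWithin_le_nhds)
  have : ProperSpace (Matrix (Fin n) (Fin p) ℝ) := FiniteDimensional.proper ℝ _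
  obtain ⟨S, hS, hSlim⟩ := (isCompact_sphere (0 : Matrix (Fin n) (Fin p) ℝ) 1).ultrafilter_le_nhds
    (u.map fun Y => ‖Y - X‖⁻¹ • (Y - X)) (by
      rw [le_principal_iff]
      refine hne.mono fun Y hY => ?_
      simp [norm_smul, hY])
  refine ⟨u, fun Y => ‖Y - X‖, S, ?_, ?_, hne, hSlim, hmem.mono fun Y hY => hY.1,
    hle (mem_inf_of_right (mem_principal_self _))⟩
  · rintro rfl
    simp at hS
  · simpa using (hlim.sub_const X).norm

/-- Theorem 2.2 of the paper, second-order optimality conditions on the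
tangent space.
(1) If `X` is a local minimizer of the KS minimization problem and `ε_xc` is twice
differentiable at `ρ(X)`, then with `Λ = XᵀH(X)X`, for every `S` with `XᵀS + SᵀX = 0`,
`tr(SᵀH(X)S − Λ SᵀS) + 2 diag(XSᵀ)ᵀ J(ρ(X)) diag(XSᵀ) ≥ 0`.
(2) Conversely, if `XᵀX = I`, `H(X)X = XΛ` with `Λ = XᵀH(X)X` symmetric, and the above
inequality is strict for every nonzero tangent `S`, then `X` is a strict local minimizer. -/
theorem second_order_conditions_tangent {n p : ℕ} (hp : 1 ≤ p) (hpn : p ≤ n)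
    (L Vion Ld : Matrix (Fin n) (Fin n) ℝ)
    (hL : L.IsHermitian) (hVion : Vion.IsHermitian)
    (hMP1 : L * Ld * L = L) (hMP2 : Ld * L * Ld = Ld)
    (hMP3 : (L * Ld)ᵀ = L * Ld) (hMP4 : (Ld * L)ᵀ = Ld * L)
    (εxc : (Fin n → ℝ) → (Fin n → ℝ)) :
    (∀ X : Matrix (Fin n) (Fin p) ℝ,
      IsLocalMinOn (EKS L Vion Ld εxc) {Y : Matrix (Fin n) (Fin p) ℝ | Yᵀ * Y = 1} X →
      X ∈ {Y : Matrix (Fin n) (Fin p) ℝ | Yᵀ * Y = 1} →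
      ContDiffAt ℝ 2 εxc (rhoX X) →
      ∀ S : Matrix (Fin n) (Fin p) ℝ, Xᵀ * S + Sᵀ * X = 0 →
        Matrix.trace (Sᵀ * HKS L Vion Ld εxc X * S
            - (Xᵀ * HKS L Vion Ld εxc X * X) * (Sᵀ * S))
          + 2 * (dvec X S ⬝ᵥ (JKS Ld εxc (rhoX X)).mulVec (dvec X S)) ≥ 0) ∧
    (ContDiff ℝ 2 εxc →
      ∀ X : Matrix (Fin n) (Fin p) ℝ, ∀ Λ : Matrix (Fin p) (Fin p) ℝ,
      Xᵀ * X = 1 →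
      HKS L Vion Ld εxc X * X = X * Λ →
      Λ = Xᵀ * HKS L Vion Ld εxc X * X →
      Λᵀ = Λ →
      (∀ S : Matrix (Fin n) (Fin p) ℝ, S ≠ 0 → Xᵀ * S + Sᵀ * X = 0 →
        Matrix.trace (Sᵀ * HKS L Vion Ld εxc X * S - Λ * (Sᵀ * S))
          + 2 * (dvec X S ⬝ᵥ (JKS Ld εxc (rhoX X)).mulVec (dvec X S)) > 0) →
      ∀ᶠ Y in nhdsWithin X ({Y : Matrix (Fin n) (Fin p) ℝ | Yᵀ * Y = 1} \ {X}),
        EKS L Vion Ld εxc X < EKS L Vion Ld εxc Y) := by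
  have hL' : Lᵀ = L := by simpa using hL.eq
  have hV' : Vionᵀ = Vion := by simpa using hVion.eq
  have hLd' : Ldᵀ = Ld := transpose_eq_self_of_penrose hL' hMP1 hMP2 hMP3 hMP4
  refine ⟨fun X hmin hX hε S hS => ?_, fun hε X Λ hX hHX hΛ hΛt hpos => ?_⟩
  · have hHX := HKS_mul_eq_of_isLocalMinOn hL' hV' hLd' hε hX hmin
    have hΛt : (Xᵀ * HKS L Vion Ld εxc X * X)ᵀ = Xᵀ * HKS L Vion Ld εxc X * X := by
      simp [HKS_transpose hL' hV', Matrix.mul_assoc]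
    obtain ⟨T, hT, hM, hE⟩ := exists_stiefel_curve_EKS_le hX hmin hS
    have hlim := tendsto_EKS_sub_div_sq_of_stiefel hL' hV' hLd' hε hX hHX hΛt
      tendsto_id_nhdsGT_zero eventually_nhdsGT_ne_zero hT hM
    have := ge_of_tendsto hlim (hE.mono fun t ht => div_nonneg (sub_nonneg.2 ht) (sq_nonneg t))
    linarith
  · by_contra hcon
    obtain ⟨u, c, S, hS0, hc, hc0, hT, hM, hE⟩ :=
      exists_ultrafilter_tendsto_direction (not_eventually.1 hcon)
    have hY : ∀ᶠ Y in (u : Filter (Matrix (Fin n) (Fin p) ℝ)), X + c Y • (c Y)⁻¹ • (Y - X) = Y :=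
      hc0.mono fun Y hY => by rw [smul_inv_smul₀ hY, add_sub_cancel]
    have hM' : ∀ᶠ Y in (u : Filter (Matrix (Fin n) (Fin p) ℝ)), (X + c Y • (c Y)⁻¹ • (Y - X))ᵀ
        * (X + c Y • (c Y)⁻¹ • (Y - X)) = 1 := by
      filter_upwards [hY, hM] with Y h1 h2
      rw [h1, h2]
    have hlim := tendsto_EKS_sub_div_sq_of_stiefel hL' hV' hLd' hε.contDiffAt hX hHX hΛt
      hc hc0 hT hM'
    have hle := le_of_tendsto hlim (b := 0) (by
      filter_upwards [hY, hE] with Y h1 h2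
      rw [h1]
      exact div_nonpos_of_nonpos_of_nonneg (sub_nonpos.2 (not_lt.1 h2)) (sq_nonneg _))
    have := hpos S hS0 (transpose_mul_add_eq_zero_of_tendsto hX hc hc0 hT hM')
    linarith
end

section
/- Suppose the gap assumption holds at H(V), i.e. λ_{p+1}(H(V)) > λ_p(H(V)). Then the map F_φ is continuously differentiable at V, and its directional derivative at V along any z ∈ ℝⁿ is ∂_V F_φ(V)[z] = diag( Q ( g ∘ (Qᵀ Diag(z) Q) ) Qᵀ ), where H(V) = QΠQᵀ is an eigendecomposition with orthogonal Q and eigenvalues λ₁ ≤ … ≤ λ_n on the diagonal of Π, ∘ is the Hadamard (entrywise) product, and g ∈ ℝ^{n×n} has entries g_{ij} = −1/|λ_i − λ_j| whenever exactly one of λ_i, λ_j is ≤ λ_p and the other is ≥ λ_{p+1}, and g_{ij} = 0 otherwise. -/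
open Matrix Filter

/-- Eigenvalues of a real symmetric matrix, sorted in ascending order
(junk value `0` if the matrix is not symmetric). -/
noncomputable def eig {n : ℕ} (A : Matrix (Fin n) (Fin n) ℝ) : Fin n → ℝ :=
  if h : A.IsHermitian then h.eigenvalues ∘ (Tuple.sort h.eigenvalues) else 0

/-- Orthogonal spectral projector onto the invariant subspace spanned by eigenvectors
associated with the `p` smallest eigenvalues of a symmetric matrix. -/
noncomputable def specProj {n : ℕ} (p : ℕ) (A : Matrix (Fin n) (Fin n) ℝ) :
    Matrix (Fin n) (Fin n) ℝ :=
  if h : A.IsHermitian then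
    (h.eigenvectorUnitary : Matrix (Fin n) (Fin n) ℝ) *
      Matrix.diagonal (fun k => if (((Tuple.sort h.eigenvalues).symm k : Fin n) : ℕ) < p
        then (1 : ℝ) else 0) *
      star (h.eigenvectorUnitary : Matrix (Fin n) (Fin n) ℝ)
  else 0

/-- The Hamiltonian `H(V) = (1/2)L + V_ion + Diag(V)`. -/
noncomputable def Hmat {n : ℕ} (L Vion : Matrix (Fin n) (Fin n) ℝ) (V : Fin n → ℝ) :
    Matrix (Fin n) (Fin n) ℝ :=
  (1 / 2 : ℝ) • L + Vion + Matrix.diagonal V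

/-- `F_φ(V) = diag(P_p(V))`. -/
noncomputable def Fphi {n : ℕ} (p : ℕ) (L Vion : Matrix (Fin n) (Fin n) ℝ) (V : Fin n → ℝ) :
    Fin n → ℝ :=
  fun i => specProj p (Hmat L Vion V) i i

/-- The first divided difference matrix `g` built from the ascending eigenvalues `λ` of
`H(V)`: `g_{ij} = −1/|λ_i − λ_j|` when exactly one of `λ_i, λ_j` is `≤ λ_p` and the other is
`≥ λ_{p+1}`, and `g_{ij} = 0` otherwise. -/
noncomputable def gmat {n : ℕ} (lam : Fin n → ℝ) (lp lp1 : ℝ) : Matrix (Fin n) (Fin n) ℝ :=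
  Matrix.of fun i j =>
    if (lam i ≤ lp ∧ lp1 ≤ lam j) ∨ (lam j ≤ lp ∧ lp1 ≤ lam i) then
      -1 / |lam i - lam j| else 0

open Topology

section OrthogonalConjugation

variable {n : ℕ}

theorem conj_diagonal_mul_conj_diagonal {U : Matrix (Fin n) (Fin n) ℝ} (hU : Uᵀ * U = 1)
    (a b : Fin n → ℝ) :
    U * diagonal a * Uᵀ * (U * diagonal b * Uᵀ) = U * diagonal (fun i => a i * b i) * Uᵀ := by
  calc U * diagonal a * Uᵀ * (U * diagonal b * Uᵀ)
      = U * diagonal a * (Uᵀ * U) * diagonal b * Uᵀ := by simp only [Matrix.mul_assoc]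
    _ = U * diagonal (fun i => a i * b i) * Uᵀ := by
        rw [hU, Matrix.mul_one, Matrix.mul_assoc U, diagonal_mul_diagonal]

theorem conj_diagonal_const {U : Matrix (Fin n) (Fin n) ℝ} (hU : Uᵀ * U = 1) (c : ℝ) :
    U * diagonal (fun _ => c) * Uᵀ = c • (1 : Matrix (Fin n) (Fin n) ℝ) := by
  rw [← smul_one_eq_diagonal, Matrix.mul_smul, Matrix.smul_mul, Matrix.mul_one,
    mul_eq_one_comm.mp hU]

theorem conj_diagonal_sub (U : Matrix (Fin n) (Fin n) ℝ) (a b : Fin n → ℝ) :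
    U * diagonal a * Uᵀ - U * diagonal b * Uᵀ = U * diagonal (fun i => a i - b i) * Uᵀ := by
  rw [← Matrix.sub_mul, ← Matrix.mul_sub, diagonal_sub]

theorem trace_conj_diagonal {U : Matrix (Fin n) (Fin n) ℝ} (hU : Uᵀ * U = 1) (a : Fin n → ℝ) :
    (U * diagonal a * Uᵀ).trace = ∑ i, a i := by
  rw [Matrix.trace_mul_comm, ← Matrix.mul_assoc, hU, Matrix.one_mul, trace_diagonal]

/-- A function of a symmetric matrix does not depend on the chosen eigendecomposition. -/
theorem conj_diagonal_comp_eq {U Q : Matrix (Fin n) (Fin n) ℝ} (hU : Uᵀ * U = 1)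
    (hQ : Qᵀ * Q = 1) {d e : Fin n → ℝ} (h : U * diagonal d * Uᵀ = Q * diagonal e * Qᵀ)
    (φ : ℝ → ℝ) : U * diagonal (φ ∘ d) * Uᵀ = Q * diagonal (φ ∘ e) * Qᵀ := by
  have hU' := mul_eq_one_comm.mp hU
  have hQ' := mul_eq_one_comm.mp hQ
  have h1 : diagonal d * (Uᵀ * Q) = Uᵀ * Q * diagonal e := by
    calc diagonal d * (Uᵀ * Q) = (Uᵀ * U) * diagonal d * (Uᵀ * Q) := by rw [hU, Matrix.one_mul]
      _ = Uᵀ * (U * diagonal d * Uᵀ) * Q := by simp only [Matrix.mul_assoc]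
      _ = Uᵀ * Q * diagonal e * (Qᵀ * Q) := by rw [h]; simp only [Matrix.mul_assoc]
      _ = _ := by rw [hQ, Matrix.mul_one]
  have h2 : diagonal (φ ∘ d) * (Uᵀ * Q) = Uᵀ * Q * diagonal (φ ∘ e) := by
    ext i j
    have h3 := congrFun (congrFun h1 i) j
    rw [diagonal_mul, mul_diagonal] at h3 ⊢
    by_cases hz : (Uᵀ * Q) i j = 0
    · simp [hz]
    · have : d i = e j := mul_right_cancel₀ hz (by rw [h3, mul_comm])
      simp [this, mul_comm]
  calc U * diagonal (φ ∘ d) * Uᵀ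
      = U * (diagonal (φ ∘ d) * (Uᵀ * Q)) * Qᵀ := by
        simp only [Matrix.mul_assoc, hQ', Matrix.mul_one]
    _ = (U * Uᵀ) * Q * diagonal (φ ∘ e) * Qᵀ := by rw [h2]; simp only [Matrix.mul_assoc]
    _ = _ := by rw [hU', Matrix.one_mul]

end OrthogonalConjugation

section SortedEigendecomposition

variable {n : ℕ}

theorem eig_monotone (A : Matrix (Fin n) (Fin n) ℝ) : Monotone (eig A) := by
  unfold eig
  split_ifs with h
  · exact Tuple.monotone_sort _
  · exact monotone_const

theorem exists_eig_decomposition {A : Matrix (Fin n) (Fin n) ℝ} (hA : A.IsHermitian) (p : ℕ) :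
    ∃ U : Matrix (Fin n) (Fin n) ℝ, Uᵀ * U = 1 ∧ A = U * diagonal (eig A) * Uᵀ ∧
      specProj p A = U * diagonal (fun i : Fin n => if (i : ℕ) < p then (1 : ℝ) else 0) * Uᵀ := by
  set E : Matrix (Fin n) (Fin n) ℝ := (hA.eigenvectorUnitary : Matrix (Fin n) (Fin n) ℝ) with hE
  set σ := Tuple.sort hA.eigenvalues with hσ
  have hEE : Eᵀ * E = 1 := by
    have := Unitary.coe_star_mul_self hA.eigenvectorUnitary
    rwa [star_eq_conjTranspose, conjTranspose_eq_transpose_of_trivial] at this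
  have hstar : star E = Eᵀ := by
    rw [star_eq_conjTranspose, conjTranspose_eq_transpose_of_trivial]
  have key : ∀ f : Fin n → ℝ, E * diagonal f * Eᵀ =
      E.submatrix id σ * diagonal (f ∘ σ) * (E.submatrix id σ)ᵀ := by
    intro f
    ext a b
    rw [Matrix.mul_apply, Matrix.mul_apply, ← Equiv.sum_comp σ]
    simp [mul_diagonal]
  refine ⟨E.submatrix id σ, ?_, ?_, ?_⟩
  · rw [transpose_submatrix, show (id : Fin n → Fin n) = Equiv.refl _ from rfl,
      submatrix_mul_equiv Eᵀ E σ (Equiv.refl _) σ, hEE]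
    simp
  · have h1 := hA.spectral_theorem
    rw [Unitary.conjStarAlgAut_apply] at h1
    have h2 : eig A = hA.eigenvalues ∘ σ := dif_pos hA
    rw [h2, ← key, ← hstar]
    exact h1
  · rw [specProj, dif_pos hA, ← hE, ← hσ, hstar, key]
    congr 3
    ext i
    simp

theorem lt_iff_eig_le_of_card {A : Matrix (Fin n) (Fin n) ℝ} {p : ℕ} {c : ℝ}
    (h : (Finset.univ.filter fun i => eig A i ≤ c).card = p) (i : Fin n) :
    (i : ℕ) < p ↔ eig A i ≤ c := by
  rw [← h]
  exact Tuple.lt_card_le_iff_apply_le_of_monotone (eig_monotone A)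

end SortedEigendecomposition

section Accretive

variable {n : ℕ}

/-- A real matrix, not necessarily symmetric, whose quadratic form is positive definite. -/
def StrictlyAccretive (X : Matrix (Fin n) (Fin n) ℝ) : Prop :=
  ∀ v : Fin n → ℝ, v ≠ 0 → 0 < v ⬝ᵥ (X *ᵥ v)

theorem dotProduct_conj_diagonal_mulVec (U : Matrix (Fin n) (Fin n) ℝ) (m v : Fin n → ℝ) :
    v ⬝ᵥ ((U * diagonal m * Uᵀ) *ᵥ v) = ∑ i, m i * (Uᵀ *ᵥ v) i ^ 2 := by
  rw [← Matrix.mulVec_mulVec, ← Matrix.mulVec_mulVec, Matrix.dotProduct_mulVec,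
    ← Matrix.mulVec_transpose, dotProduct]
  refine Finset.sum_congr rfl fun i _ => ?_
  rw [mulVec_diagonal]
  ring

theorem strictlyAccretive_conj_diagonal {U : Matrix (Fin n) (Fin n) ℝ} (hU : Uᵀ * U = 1)
    {m : Fin n → ℝ} (hm : ∀ i, 0 < m i) : StrictlyAccretive (U * diagonal m * Uᵀ) := by
  intro v hv
  rw [dotProduct_conj_diagonal_mulVec]
  have hw : Uᵀ *ᵥ v ≠ 0 := by
    intro h
    apply hv
    rw [← Matrix.one_mulVec v, ← mul_eq_one_comm.mp hU, ← Matrix.mulVec_mulVec, h,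
      Matrix.mulVec_zero]
  obtain ⟨i, hi⟩ := Function.ne_iff.mp hw
  refine Finset.sum_pos' (fun j _ => mul_nonneg (hm j).le (sq_nonneg _)) ⟨i, Finset.mem_univ _, ?_⟩
  exact mul_pos (hm i) (sq_pos_of_ne_zero hi)

theorem StrictlyAccretive.pos_of_conj_diagonal {U : Matrix (Fin n) (Fin n) ℝ} (hU : Uᵀ * U = 1)
    {m : Fin n → ℝ} (h : StrictlyAccretive (U * diagonal m * Uᵀ)) (i : Fin n) : 0 < m i := by
  have hw : Uᵀ *ᵥ (U *ᵥ Pi.single i 1) = Pi.single i (1 : ℝ) := by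
    rw [Matrix.mulVec_mulVec, hU, Matrix.one_mulVec]
  have hv : U *ᵥ Pi.single i (1 : ℝ) ≠ 0 := by
    intro h0
    rw [h0, Matrix.mulVec_zero] at hw
    simpa using congrFun hw i
  have := h _ hv
  rw [dotProduct_conj_diagonal_mulVec, hw] at this
  simpa [Pi.single_apply] using this

/-- Uniqueness for the Sylvester equation `X E + E M = 0`. -/
theorem StrictlyAccretive.sylvester_eq_zero {X U E : Matrix (Fin n) (Fin n) ℝ} {m : Fin n → ℝ}
    (hX : StrictlyAccretive X) (hU : Uᵀ * U = 1) (hm : ∀ i, 0 ≤ m i)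
    (h : X * E + E * (U * diagonal m * Uᵀ) = 0) : E = 0 := by
  have h1 : X * (E * U) + E * U * diagonal m = 0 := by
    calc X * (E * U) + E * U * diagonal m
        = X * (E * U) + E * U * diagonal m * (Uᵀ * U) := by rw [hU, Matrix.mul_one]
      _ = (X * E + E * (U * diagonal m * Uᵀ)) * U := by
          simp only [Matrix.add_mul, Matrix.mul_assoc]
      _ = 0 := by rw [h, Matrix.zero_mul]
  have h2 : E * U = 0 := by
    ext i j
    by_contra hne
    have hv : (fun k => (E * U) k j) ≠ 0 := fun h0 => hne (congrFun h0 i)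
    have hpos := hX _ hv
    have hXv : X *ᵥ (fun k => (E * U) k j) = fun k => -((E * U) k j * m j) := by
      ext k
      have h3 := congrFun (congrFun h1 k) j
      rw [Matrix.add_apply, mul_diagonal, Matrix.mul_apply, Matrix.zero_apply] at h3
      exact eq_neg_of_add_eq_zero_left h3
    rw [hXv, dotProduct] at hpos
    refine absurd hpos (not_lt.mpr (Finset.sum_nonpos fun k _ => ?_))
    nlinarith [mul_nonneg (hm j) (sq_nonneg ((E * U) k j))]
  rw [← Matrix.mul_one E, ← mul_eq_one_comm.mp hU, ← Matrix.mul_assoc, h2, Matrix.zero_mul]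

theorem StrictlyAccretive.eventually {X₀ : Matrix (Fin n) (Fin n) ℝ} (h : StrictlyAccretive X₀) :
    ∀ᶠ X in 𝓝 X₀, StrictlyAccretive X := by
  have hcont : Continuous fun z : Matrix (Fin n) (Fin n) ℝ × (Fin n → ℝ) =>
      z.2 ⬝ᵥ (z.1 *ᵥ z.2) :=
    continuous_snd.dotProduct (continuous_fst.matrix_mulVec continuous_snd)
  have hs := (isCompact_sphere (0 : Fin n → ℝ) 1).eventually_forall_of_forall_eventually
    (x₀ := X₀) (P := fun X v => 0 < v ⬝ᵥ (X *ᵥ v)) fun v hv =>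
      hcont.continuousAt.eventually (lt_mem_nhds (h v (ne_zero_of_mem_unit_sphere ⟨v, hv⟩)))
  filter_upwards [hs] with X hX v hv
  have hpos := hX (‖v‖⁻¹ • v) (by simp [norm_smul, hv])
  rw [Matrix.mulVec_smul, smul_dotProduct, dotProduct_smul, smul_smul, smul_eq_mul] at hpos
  exact pos_of_mul_pos_right hpos (mul_self_nonneg _)

end Accretive

section Smoothness

open scoped Matrix.Norms.Operator

variable {n : ℕ}

/-- Smooth local square root of matrices near the square of a positive definite matrix. -/
theorem exists_contDiffAt_sqrt {U : Matrix (Fin n) (Fin n) ℝ} (hU : Uᵀ * U = 1)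
    {m : Fin n → ℝ} (hm : ∀ i, 0 < m i) {M : Matrix (Fin n) (Fin n) ℝ}
    (hM : M = U * diagonal m * Uᵀ) :
    ∃ ψ : Matrix (Fin n) (Fin n) ℝ → Matrix (Fin n) (Fin n) ℝ,
      ContDiffAt ℝ 1 ψ (M * M) ∧ ψ (M * M) = M ∧ ∀ᶠ Y in 𝓝 (M * M), ψ Y * ψ Y = Y := by
  have hacc : StrictlyAccretive M := hM ▸ strictlyAccretive_conj_diagonal hU hm
  let T : Matrix (Fin n) (Fin n) ℝ →ₗ[ℝ] Matrix (Fin n) (Fin n) ℝ :=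
    LinearMap.mulLeft ℝ M + LinearMap.mulRight ℝ M
  have hinj : Function.Injective T := by
    rw [injective_iff_map_eq_zero]
    intro E hE
    refine hacc.sylvester_eq_zero hU (fun i => (hm i).le) ?_
    rw [← hM]
    exact hE
  let T' := (LinearEquiv.ofInjectiveEndo T hinj).toContinuousLinearEquiv
  have hsq : ContDiffAt ℝ 1 (fun X : Matrix (Fin n) (Fin n) ℝ => X * X) M :=
    contDiffAt_id.mul contDiffAt_id
  have hderiv : HasFDerivAt (fun X : Matrix (Fin n) (Fin n) ℝ => X * X)
      (T' : Matrix (Fin n) (Fin n) ℝ →L[ℝ] Matrix (Fin n) (Fin n) ℝ) M := by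
    refine ((hasFDerivAt_id M).mul' (hasFDerivAt_id M)).congr_fderiv ?_
    ext1 E
    rfl
  have hstrict := hsq.hasStrictFDerivAt' hderiv one_ne_zero
  exact ⟨hsq.localInverse hderiv one_ne_zero, hsq.to_localInverse hderiv one_ne_zero,
    hsq.localInverse_apply_image hderiv one_ne_zero, hstrict.eventually_right_inverse⟩

/-- The spectral projector below `c` expressed through the matrix sign function of `A - c`. -/
theorem half_one_sub_sign_eq {U A : Matrix (Fin n) (Fin n) ℝ} (hU : Uᵀ * U = 1)
    {e : Fin n → ℝ} (hA : A = U * diagonal e * Uᵀ) {c : ℝ} (hc : ∀ i, 0 < |e i - c|) :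
    (1 / 2 : ℝ) • (1 - (A - c • (1 : Matrix (Fin n) (Fin n) ℝ)) *
        Ring.inverse (U * diagonal (fun i => |e i - c|) * Uᵀ)) =
      U * diagonal (fun i => if e i ≤ c then (1 : ℝ) else 0) * Uᵀ := by
  have hone := conj_diagonal_const hU 1
  rw [one_smul] at hone
  have hinv : Ring.inverse (U * diagonal (fun i => |e i - c|) * Uᵀ) =
      U * diagonal (fun i => |e i - c|⁻¹) * Uᵀ := by
    rw [← Matrix.nonsing_inv_eq_ringInverse]
    apply Matrix.inv_eq_right_inv
    rw [conj_diagonal_mul_conj_diagonal hU, ← hone]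
    congr 3
    ext i
    exact mul_inv_cancel₀ (hc i).ne'
  rw [hinv, ← conj_diagonal_const hU c, hA, conj_diagonal_sub, conj_diagonal_mul_conj_diagonal hU,
    ← hone, conj_diagonal_sub, ← Matrix.smul_mul, ← Matrix.mul_smul, ← diagonal_smul]
  congr 3
  ext i
  have hi := hc i
  simp only [Pi.smul_apply, smul_eq_mul]
  split_ifs with h
  · have hlt : e i - c < 0 := lt_of_le_of_ne (by linarith) (abs_pos.mp hi)
    rw [abs_of_neg hlt, inv_neg, mul_neg, mul_inv_cancel₀ hlt.ne]
    norm_num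
  · have hlt : 0 < e i - c := by linarith
    rw [abs_of_pos hlt, mul_inv_cancel₀ hlt.ne']
    norm_num

theorem sub_smul_one_mul_self_eq {U A : Matrix (Fin n) (Fin n) ℝ} (hU : Uᵀ * U = 1)
    {e : Fin n → ℝ} (hA : A = U * diagonal e * Uᵀ) (c : ℝ) :
    (A - c • (1 : Matrix (Fin n) (Fin n) ℝ)) * (A - c • (1 : Matrix (Fin n) (Fin n) ℝ)) =
      U * diagonal (fun i => |e i - c|) * Uᵀ * (U * diagonal (fun i => |e i - c|) * Uᵀ) := by
  rw [← conj_diagonal_const hU c, hA, conj_diagonal_sub, conj_diagonal_mul_conj_diagonal hU,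
    conj_diagonal_mul_conj_diagonal hU]
  simp only [abs_mul_abs_self]

/-- Near a symmetric matrix with a spectral gap at `c`, the spectral projector agrees on
symmetric matrices with a continuously differentiable map. -/
theorem exists_contDiffAt_eq_specProj {A₀ : Matrix (Fin n) (Fin n) ℝ} (hA₀ : A₀.IsHermitian)
    {p : ℕ} {c : ℝ} (hc : ∀ i, 0 < |eig A₀ i - c|)
    (hcard : (Finset.univ.filter fun i => eig A₀ i ≤ c).card = p) :
    ∃ R : Matrix (Fin n) (Fin n) ℝ → Matrix (Fin n) (Fin n) ℝ, ContDiffAt ℝ 1 R A₀ ∧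
      ∀ᶠ A in 𝓝 A₀, A.IsHermitian → specProj p A = R A := by
  obtain ⟨U₀, hU₀, hdec₀, -⟩ := exists_eig_decomposition hA₀ p
  set M₀ := U₀ * diagonal (fun i => |eig A₀ i - c|) * U₀ᵀ with hM₀
  obtain ⟨ψ, hψ, hψM, hψsq⟩ := exists_contDiffAt_sqrt hU₀ hc hM₀
  have hacc : StrictlyAccretive M₀ := strictlyAccretive_conj_diagonal hU₀ hc
  let B : Matrix (Fin n) (Fin n) ℝ → Matrix (Fin n) (Fin n) ℝ := fun A => A - c • 1
  let X : Matrix (Fin n) (Fin n) ℝ → Matrix (Fin n) (Fin n) ℝ := fun A => ψ (B A * B A)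
  let R : Matrix (Fin n) (Fin n) ℝ → Matrix (Fin n) (Fin n) ℝ := fun A =>
    (1 / 2 : ℝ) • (1 - B A * Ring.inverse (X A))
  have hB : ContDiffAt ℝ 1 B A₀ := contDiffAt_id.sub contDiffAt_const
  have hBsq : ContDiffAt ℝ 1 (fun A => B A * B A) A₀ := hB.mul hB
  have hsq₀ : B A₀ * B A₀ = M₀ * M₀ := sub_smul_one_mul_self_eq hU₀ hdec₀ c
  have hX₀ : X A₀ = M₀ := by simp only [X, hsq₀, hψM]
  have hX : ContDiffAt ℝ 1 X A₀ := by
    rw [← hsq₀] at hψ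
    exact hψ.comp A₀ hBsq
  have hMunit : IsUnit M₀ := by
    rw [Matrix.isUnit_iff_isUnit_det, isUnit_iff_ne_zero]
    intro hdet
    obtain ⟨v, hv, hv0⟩ := Matrix.exists_mulVec_eq_zero_iff.mpr hdet
    simpa [hv0] using hacc v hv
  have hR : ContDiffAt ℝ 1 R A₀ := by
    obtain ⟨u, hu⟩ := hMunit
    have hinv : ContDiffAt ℝ 1 Ring.inverse (X A₀) := by
      rw [hX₀, ← hu]
      exact contDiffAt_ringInverse ℝ u
    exact (contDiffAt_const.sub (hB.mul (hinv.comp A₀ hX))).const_smul (1 / 2 : ℝ)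
  have htrace : ∀ {U A : Matrix (Fin n) (Fin n) ℝ}, Uᵀ * U = 1 →
      R A = U * diagonal (fun i => if eig A i ≤ c then (1 : ℝ) else 0) * Uᵀ →
      (R A).trace = (Finset.univ.filter fun i => eig A i ≤ c).card := by
    intro U A hU h
    rw [h, trace_conj_diagonal hU, Finset.sum_boole]
  have hR₀ : (R A₀).trace = p := by
    rw [htrace hU₀, hcard]
    simp only [R, hX₀]
    exact half_one_sub_sign_eq hU₀ hdec₀ hc
  have hev_acc : ∀ᶠ A in 𝓝 A₀, StrictlyAccretive (X A) :=
    hX.continuousAt.eventually (hX₀ ▸ hacc).eventually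
  have hev_sq : ∀ᶠ A in 𝓝 A₀, X A * X A = B A * B A :=
    hBsq.continuousAt.eventually (hsq₀ ▸ hψsq)
  have hev_trace : ∀ᶠ A in 𝓝 A₀, |(R A).trace - p| < 1 := by
    have hcont : ContinuousAt (fun A => |(R A).trace - p|) A₀ :=
      ((((continuous_id.matrix_trace).continuousAt.comp hR.continuousAt).sub
        continuousAt_const)).abs
    refine hcont.eventually (gt_mem_nhds ?_)
    simp [hR₀]
  refine ⟨R, hR, ?_⟩
  filter_upwards [hev_acc, hev_sq, hev_trace] with A hAacc hAsq hAtr hA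
  obtain ⟨U, hU, hdec, hproj⟩ := exists_eig_decomposition hA p
  have hXA : X A = U * diagonal (fun i => |eig A i - c|) * Uᵀ := by
    rw [← sub_eq_zero]
    refine hAacc.sylvester_eq_zero hU (fun i => abs_nonneg (eig A i - c)) ?_
    have hBB : B A * B A = _ := sub_smul_one_mul_self_eq hU hdec c
    rw [Matrix.mul_sub, Matrix.sub_mul, hAsq, hBB]
    abel
  have hpos := (hXA ▸ hAacc).pos_of_conj_diagonal hU
  have hRA : R A = U * diagonal (fun i => if eig A i ≤ c then (1 : ℝ) else 0) * Uᵀ := by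
    simp only [R, hXA]
    exact half_one_sub_sign_eq hU hdec hpos
  rw [htrace hU hRA] at hAtr
  have hcardA : (Finset.univ.filter fun i => eig A i ≤ c).card = p := by
    have : |((Finset.univ.filter fun i => eig A i ≤ c).card : ℤ) - p| < 1 := by
      exact_mod_cast hAtr
    rw [Int.abs_lt_one_iff] at this
    omega
  rw [hproj, hRA]
  simp only [lt_iff_eig_le_of_card hcardA]

/-- Entrywise form, in an eigenbasis, of the derivative of a spectral projector. -/
theorem hasFDerivAt_proj_entry {E : Type*} [NormedAddCommGroup E] [NormedSpace ℝ E]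
    {G H : E → Matrix (Fin n) (Fin n) ℝ} {G' H' : E →L[ℝ] Matrix (Fin n) (Fin n) ℝ} {x : E}
    (hG : HasFDerivAt G G' x) (hH : HasFDerivAt H H' x)
    (hcomm : ∀ y, H y * G y = G y * H y) (hidem : ∀ y, G y * G y = G y)
    {Q : Matrix (Fin n) (Fin n) ℝ} (hQ : Qᵀ * Q = 1) {lam J : Fin n → ℝ}
    (hHx : H x = Q * diagonal lam * Qᵀ) (hGx : G x = Q * diagonal J * Qᵀ) (z : E) (i j : Fin n) :
    (lam i - lam j) * (Qᵀ * G' z * Q) i j = (J i - J j) * (Qᵀ * H' z * Q) i j ∧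
      (Qᵀ * G' z * Q) i j = (J i + J j) * (Qᵀ * G' z * Q) i j := by
  have hcomm' : H x * G' z + H' z * G x = G x * H' z + G' z * H x := by
    have h1 := hH.mul' hG
    have h2 := hG.mul' hH
    rw [show H * G = G * H from funext hcomm] at h1
    exact congrArg (fun T : E →L[ℝ] Matrix (Fin n) (Fin n) ℝ => T z) (h1.unique h2)
  have hidem' : G x * G' z + G' z * G x = G' z := by
    have h1 := hG.mul' hG
    rw [show G * G = G from funext hidem] at h1
    exact congrArg (fun T : E →L[ℝ] Matrix (Fin n) (Fin n) ℝ => T z) (h1.unique hG)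
  have hleft : ∀ (a : Fin n → ℝ) (Y : Matrix (Fin n) (Fin n) ℝ),
      Qᵀ * (Q * diagonal a * Qᵀ * Y) * Q = diagonal a * (Qᵀ * Y * Q) := by
    intro a Y
    calc Qᵀ * (Q * diagonal a * Qᵀ * Y) * Q
        = (Qᵀ * Q) * (diagonal a * (Qᵀ * Y * Q)) := by simp only [Matrix.mul_assoc]
      _ = _ := by rw [hQ, Matrix.one_mul]
  have hright : ∀ (a : Fin n → ℝ) (Y : Matrix (Fin n) (Fin n) ℝ),
      Qᵀ * (Y * (Q * diagonal a * Qᵀ)) * Q = Qᵀ * Y * Q * diagonal a := by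
    intro a Y
    calc Qᵀ * (Y * (Q * diagonal a * Qᵀ)) * Q
        = Qᵀ * Y * Q * diagonal a * (Qᵀ * Q) := by simp only [Matrix.mul_assoc]
      _ = _ := by rw [hQ, Matrix.mul_one]
  have e1 := congrFun (congrFun (congrArg (fun Y : Matrix (Fin n) (Fin n) ℝ => Qᵀ * Y * Q) hcomm') i) j
  have e2 := congrFun (congrFun (congrArg (fun Y : Matrix (Fin n) (Fin n) ℝ => Qᵀ * Y * Q) hidem') i) j
  simp only [hHx, hGx, Matrix.mul_add, Matrix.add_mul, hleft, hright, Matrix.add_apply,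
    diagonal_mul, mul_diagonal] at e1 e2
  constructor <;> linarith

theorem Hmat_isHermitian {L Vion : Matrix (Fin n) (Fin n) ℝ} (hL : L.IsHermitian)
    (hVion : Vion.IsHermitian) (V : Fin n → ℝ) : (Hmat L Vion V).IsHermitian := by
  refine ((?_ : ((1 / 2 : ℝ) • L).IsHermitian).add hVion).add (isHermitian_diagonal V)
  rw [IsHermitian, conjTranspose_smul, hL.eq, star_trivial]

theorem contDiff_Hmat (L Vion : Matrix (Fin n) (Fin n) ℝ) : ContDiff ℝ 1 (Hmat L Vion) :=
  contDiff_const.add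
    (LinearMap.toContinuousLinearMap (Matrix.diagonalLinearMap (Fin n) ℝ ℝ)).contDiff

theorem hasFDerivAt_Hmat (L Vion : Matrix (Fin n) (Fin n) ℝ) (V : Fin n → ℝ) :
    HasFDerivAt (Hmat L Vion)
      (LinearMap.toContinuousLinearMap (Matrix.diagonalLinearMap (Fin n) ℝ ℝ)) V :=
  (LinearMap.toContinuousLinearMap (Matrix.diagonalLinearMap (Fin n) ℝ ℝ)).hasFDerivAt.const_add _

theorem specProj_mul_self {A : Matrix (Fin n) (Fin n) ℝ} (hA : A.IsHermitian) (p : ℕ) :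
    specProj p A * specProj p A = specProj p A := by
  obtain ⟨U, hU, -, hP⟩ := exists_eig_decomposition hA p
  rw [hP, conj_diagonal_mul_conj_diagonal hU]
  congr 3
  ext i
  split_ifs <;> simp

theorem mul_specProj_comm {A : Matrix (Fin n) (Fin n) ℝ} (hA : A.IsHermitian) (p : ℕ) :
    A * specProj p A = specProj p A * A := by
  obtain ⟨U, hU, hdec, hP⟩ := exists_eig_decomposition hA p
  rw [hP]
  nth_rewrite 1 [hdec]
  nth_rewrite 2 [hdec]
  rw [conj_diagonal_mul_conj_diagonal hU, conj_diagonal_mul_conj_diagonal hU]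
  simp only [mul_comm]

/-- If `c` separates the `p` lowest eigenvalues of `H(V)` from the others, then `F_φ` is continuously
differentiable at `V`, and its derivative along `z` is the diagonal of a matrix determined,
in any eigenbasis of `H(V)`, by the linearised commutation and idempotence relations. -/
theorem Fphi_contDiffAt_and_hasFDerivAt {L Vion : Matrix (Fin n) (Fin n) ℝ} (hL : L.IsHermitian)
    (hVion : Vion.IsHermitian) {V : Fin n → ℝ} {p : ℕ} {c : ℝ}
    (hc : ∀ i, 0 < |eig (Hmat L Vion V) i - c|)
    (hcard : (Finset.univ.filter fun i => eig (Hmat L Vion V) i ≤ c).card = p) :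
    ContDiffAt ℝ 1 (Fphi p L Vion) V ∧
    ∃ f : (Fin n → ℝ) →L[ℝ] (Fin n → ℝ), HasFDerivAt (Fphi p L Vion) f V ∧
      ∀ z, ∃ D : Matrix (Fin n) (Fin n) ℝ, f z = D.diag ∧
        ∀ Q : Matrix (Fin n) (Fin n) ℝ, Qᵀ * Q = 1 →
          Hmat L Vion V = Q * diagonal (eig (Hmat L Vion V)) * Qᵀ →
          ∀ i j : Fin n,
            (eig (Hmat L Vion V) i - eig (Hmat L Vion V) j) * (Qᵀ * D * Q) i j =
                ((if (i : ℕ) < p then 1 else 0) - (if (j : ℕ) < p then 1 else 0)) *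
                  (Qᵀ * diagonal z * Q) i j ∧
              (Qᵀ * D * Q) i j =
                ((if (i : ℕ) < p then 1 else 0) + (if (j : ℕ) < p then 1 else 0)) *
                  (Qᵀ * D * Q) i j := by
  have hHerm := Hmat_isHermitian hL hVion
  obtain ⟨R, hR, hRev⟩ := exists_contDiffAt_eq_specProj (hHerm V) hc hcard
  have hH := (contDiff_Hmat L Vion).contDiffAt (x := V)
  have hG : ContDiffAt ℝ 1 (fun W => specProj p (Hmat L Vion W)) V := by
    refine (hR.comp V hH).congr_of_eventuallyEq ?_
    filter_upwards [hH.continuousAt.eventually hRev] with W hW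
    exact hW (hHerm W)
  have hG' := (hG.differentiableAt one_ne_zero).hasFDerivAt
  let dg : Matrix (Fin n) (Fin n) ℝ →L[ℝ] (Fin n → ℝ) :=
    LinearMap.toContinuousLinearMap (Matrix.diagLinearMap (Fin n) ℝ ℝ)
  refine ⟨dg.contDiff.contDiffAt.comp V hG, _, dg.hasFDerivAt.comp V hG', fun z =>
    ⟨fderiv ℝ (fun W => specProj p (Hmat L Vion W)) V z, rfl, fun Q hQ hdec i j => ?_⟩⟩
  refine hasFDerivAt_proj_entry hG' (hasFDerivAt_Hmat L Vion V)
    (fun W => mul_specProj_comm (hHerm W) p) (fun W => specProj_mul_self (hHerm W) p) hQ hdec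
    (J := fun i : Fin n => if (i : ℕ) < p then 1 else 0) ?_ z i j
  obtain ⟨U, hU, hdecU, hP⟩ := exists_eig_decomposition (hHerm V) p
  have h := conj_diagonal_comp_eq hU hQ (hdecU.symm.trans hdec)
    (fun x => if x ≤ c then (1 : ℝ) else 0)
  rw [hP]
  simpa only [lt_iff_eig_le_of_card hcard, Function.comp_def] using h

end Smoothness

/-- Lemma 3.1 of the paper: under the gap assumption
`λ_p(H(V)) < λ_{p+1}(H(V))`, the map `F_φ` is continuously differentiable at `V`, and its
derivative along `z` is `diag(Q (g ∘ (Qᵀ Diag(z) Q)) Qᵀ)` for any eigendecomposition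
`H(V) = Q Π Qᵀ` with orthogonal `Q` and ascending eigenvalues. -/
theorem Fphi_derivative {n p : ℕ} (hp : 1 ≤ p) (hpn : p < n)
    (L Vion : Matrix (Fin n) (Fin n) ℝ)
    (hL : L.IsHermitian) (hVion : Vion.IsHermitian)
    (V : Fin n → ℝ)
    (hgap : eig (Hmat L Vion V) ⟨p - 1, by omega⟩ < eig (Hmat L Vion V) ⟨p, hpn⟩) :
    ContDiffAt ℝ 1 (Fphi p L Vion) V ∧
    ∃ f : (Fin n → ℝ) →L[ℝ] (Fin n → ℝ),
      HasFDerivAt (Fphi p L Vion) f V ∧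
      ∀ Q : Matrix (Fin n) (Fin n) ℝ, Qᵀ * Q = 1 →
        Hmat L Vion V = Q * Matrix.diagonal (eig (Hmat L Vion V)) * Qᵀ →
        ∀ z : Fin n → ℝ,
          f z = fun i =>
            (Q * (Matrix.hadamard
                  (gmat (eig (Hmat L Vion V))
                    (eig (Hmat L Vion V) ⟨p - 1, by omega⟩)
                    (eig (Hmat L Vion V) ⟨p, hpn⟩))
                  (Qᵀ * Matrix.diagonal z * Q)) * Qᵀ) i i := by
  set A := Hmat L Vion V with hAdef
  have hmono := eig_monotone A
  set lp := eig A ⟨p - 1, by omega⟩ with hlp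
  set lp1 := eig A ⟨p, hpn⟩ with hlp1
  have hlow : ∀ i : Fin n, (i : ℕ) < p → eig A i ≤ lp := fun i hi =>
    hmono (Fin.mk_le_mk.mpr (by omega : (i : ℕ) ≤ p - 1))
  have hhigh : ∀ i : Fin n, ¬ (i : ℕ) < p → lp1 ≤ eig A i := fun i hi =>
    hmono (Fin.mk_le_mk.mpr (by omega : p ≤ (i : ℕ)))
  obtain ⟨c, hc1, hc2⟩ := exists_between hgap
  have hlt : ∀ i : Fin n, (i : ℕ) < p ↔ eig A i ≤ c := fun i =>
    ⟨fun hi => (hlow i hi).trans hc1.le, fun hi => by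
      by_contra hn
      linarith [hhigh i hn]⟩
  have hne : ∀ i, 0 < |eig A i - c| := fun i => by
    rw [abs_pos, sub_ne_zero]
    by_cases hi : (i : ℕ) < p
    · exact ((hlow i hi).trans_lt hc1).ne
    · exact (hc2.trans_le (hhigh i hi)).ne'
  have hcard : (Finset.univ.filter fun i => eig A i ≤ c).card = p := by
    simp only [← hlt]
    rw [Fin.card_filter_val_lt, min_eq_right hpn.le]
  obtain ⟨hcont, f, hf, hfz⟩ := Fphi_contDiffAt_and_hasFDerivAt hL hVion hne hcard
  refine ⟨hcont, f, hf, fun Q hQ hdec z => ?_⟩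
  obtain ⟨D, hD, hentry⟩ := hfz z
  have hDQ : Qᵀ * D * Q = Matrix.hadamard (gmat (eig A) lp lp1) (Qᵀ * Matrix.diagonal z * Q) := by
    ext i j
    obtain ⟨h1, h2⟩ := hentry Q hQ hdec i j
    rw [← hAdef] at h1
    rw [hadamard_apply, gmat, of_apply]
    by_cases hi : (i : ℕ) < p <;> by_cases hj : (j : ℕ) < p <;>
      simp only [hi, hj, if_true, if_false] at h1 h2
    · rw [if_neg (by rintro (⟨-, h⟩ | ⟨-, h⟩) <;> linarith [hlow i hi, hlow j hj])]
      linarith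
    · have hlt' : eig A i - eig A j < 0 := by linarith [hlow i hi, hhigh j hj]
      rw [if_pos (Or.inl ⟨hlow i hi, hhigh j hj⟩), abs_of_neg hlt', neg_div_neg_eq,
        div_mul_eq_mul_div, eq_div_iff hlt'.ne]
      linarith
    · have hlt' : 0 < eig A i - eig A j := by linarith [hlow j hj, hhigh i hi]
      rw [if_pos (Or.inr ⟨hlow j hj, hhigh i hi⟩), abs_of_pos hlt', div_mul_eq_mul_div,
        eq_div_iff hlt'.ne']
      linarith
    · rw [if_neg (by rintro (⟨h, -⟩ | ⟨h, -⟩) <;> linarith [hhigh i hi, hhigh j hj])]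
      linarith
  have hQ' := mul_eq_one_comm.mp hQ
  have hDeq : D = Q * (Qᵀ * D * Q) * Qᵀ := by
    calc D = (Q * Qᵀ) * D * (Q * Qᵀ) := by rw [hQ', Matrix.one_mul, Matrix.mul_one]
      _ = _ := by simp only [Matrix.mul_assoc]
  rw [hD, ← hDQ, ← hDeq]
  rfl
end

section
/- Suppose Assumption (xc-bound) holds with constant θ and b₂ := 1 − β(‖L†‖₂ + θ)/4 > 0. Let {V^i} be generated by the simple mixing scheme V^{i+1} = V^i − α (V^i − 𝒱(F_{f_μ}(V^i))) with a step size α satisfying 0 < α < 2/(2 − b₂). Then {V^i} converges to a point V* solving V* = 𝒱(F_{f_μ}(V*)), with linear convergence rate no more than |1−α| + α(1−b₂) < 1; that is, ‖V^{i+1} − V*‖₂ ≤ (|1−α| + α(1−b₂)) ‖V^i − V*‖₂ for all i. -/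
open Matrix Filter

/-- Euclidean (ℓ²) norm of a vector in `Fin n → ℝ`. -/
noncomputable def vnorm {n : ℕ} (v : Fin n → ℝ) : ℝ := Real.sqrt (∑ i, v i ^ 2)

/-- Spectral (ℓ² operator) norm of a real matrix. -/
noncomputable def specNorm {m k : ℕ} (A : Matrix (Fin m) (Fin k) ℝ) : ℝ :=
  ‖LinearMap.toContinuousLinearMap (Matrix.toEuclideanLin A)‖

/-- The Fermi–Dirac distribution `f_μ(t) = 1/(1 + e^{β(t−μ)})`. -/
noncomputable def fFD (β μ t : ℝ) : ℝ := 1 / (1 + Real.exp (β * (t - μ)))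

/-- A real function applied to a symmetric matrix through the spectral functional calculus
(junk value `0` if the matrix is not symmetric). -/
noncomputable def matFun {n : ℕ} (φ : ℝ → ℝ) (A : Matrix (Fin n) (Fin n) ℝ) :
    Matrix (Fin n) (Fin n) ℝ :=
  if h : A.IsHermitian then
    (h.eigenvectorUnitary : Matrix (Fin n) (Fin n) ℝ) *
      Matrix.diagonal (fun k => φ (h.eigenvalues k)) *
      star (h.eigenvectorUnitary : Matrix (Fin n) (Fin n) ℝ)
  else 0

/-- `F_{f_μ}(V) = diag(f_{μ(V)}(H(V)))`, where `μf V` is the chemical potential. -/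
noncomputable def Ffd {n : ℕ} (β : ℝ) (μf : (Fin n → ℝ) → ℝ)
    (L Vion : Matrix (Fin n) (Fin n) ℝ) (V : Fin n → ℝ) : Fin n → ℝ :=
  fun i => matFun (fFD β (μf V)) (Hmat L Vion V) i i

/-- The potential map `𝒱(ρ) = L†ρ + μ_xc(ρ)ᵀe`, with `m ρ = μ_xc(ρ)ᵀe`. -/
noncomputable def potMap {n : ℕ} (Ld : Matrix (Fin n) (Fin n) ℝ)
    (m : (Fin n → ℝ) → (Fin n → ℝ)) (ρ : Fin n → ℝ) : Fin n → ℝ :=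
  Ld.mulVec ρ + m ρ

theorem vnorm_eq_norm {n : ℕ} (v : Fin n → ℝ) : vnorm v = ‖WithLp.toLp 2 v‖ := by
  simp [vnorm, EuclideanSpace.norm_eq]

theorem vnorm_nonneg {n : ℕ} (v : Fin n → ℝ) : 0 ≤ vnorm v := Real.sqrt_nonneg _

theorem vnorm_sq {n : ℕ} (v : Fin n → ℝ) : vnorm v ^ 2 = ∑ i, v i ^ 2 :=
  Real.sq_sqrt (Finset.sum_nonneg fun _ _ => sq_nonneg _)

theorem vnorm_mulVec_le {m k : ℕ} (A : Matrix (Fin m) (Fin k) ℝ) (v : Fin k → ℝ) :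
    vnorm (A *ᵥ v) ≤ specNorm A * vnorm v := by
  rw [vnorm_eq_norm, vnorm_eq_norm]
  exact (LinearMap.toContinuousLinearMap (Matrix.toEuclideanLin A)).le_opNorm (WithLp.toLp 2 v)

theorem vnorm_sub_le_of_vnorm_fderiv_le {n : ℕ} {m : (Fin n → ℝ) → (Fin n → ℝ)} {θ : ℝ}
    (hθ : 0 ≤ θ) (hm : Differentiable ℝ m)
    (bound : ∀ ρ z : Fin n → ℝ, vnorm (fderiv ℝ m ρ z) ≤ θ * vnorm z) (x y : Fin n → ℝ) :
    vnorm (m x - m y) ≤ θ * vnorm (x - y) := by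
  let e := EuclideanSpace.equiv (Fin n) ℝ
  have hderiv (u : EuclideanSpace ℝ (Fin n)) : HasFDerivAt (fun u => e.symm (m (e u)))
      ((e.symm : (Fin n → ℝ) →L[ℝ] EuclideanSpace ℝ (Fin n)).comp
        ((fderiv ℝ m (e u)).comp (e : EuclideanSpace ℝ (Fin n) →L[ℝ] (Fin n → ℝ)))) u :=
    e.symm.hasFDerivAt.comp u ((hm (e u)).hasFDerivAt.comp u e.hasFDerivAt)
  have key := convex_univ.norm_image_sub_le_of_norm_hasFDerivWithin_le
    (fun u _ => (hderiv u).hasFDerivWithinAt)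
    (fun u _ => ContinuousLinearMap.opNorm_le_bound _ hθ fun z => by
      have := bound (e u) (e z)
      rw [vnorm_eq_norm, vnorm_eq_norm] at this
      exact this)
    (Set.mem_univ (e.symm y)) (Set.mem_univ (e.symm x))
  rw [vnorm_eq_norm, vnorm_eq_norm]
  exact key

theorem Real.sq_sigmoid_sub_le (x y : ℝ) :
    (sigmoid x - sigmoid y) ^ 2 ≤ 1 / 4 * ((sigmoid x - sigmoid y) * (x - y)) := by
  have hlip : |sigmoid x - sigmoid y| ≤ 1 / 4 * |x - y| := by
    refine convex_univ.norm_image_sub_le_of_norm_deriv_le (𝕜 := ℝ) (f := sigmoid) (C := 1 / 4)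
      (fun _ _ => differentiableAt_sigmoid) (fun z _ => ?_) (Set.mem_univ y) (Set.mem_univ x)
    have h0 := sigmoid_nonneg z
    have h1 := sigmoid_le_one z
    rw [deriv_sigmoid, Real.norm_eq_abs, abs_of_nonneg (mul_nonneg h0 (by linarith))]
    nlinarith [sq_nonneg (sigmoid z - 1 / 2)]
  have hmono : 0 ≤ (sigmoid x - sigmoid y) * (x - y) := by
    rcases le_total x y with h | h
    · exact mul_nonneg_of_nonpos_of_nonpos (sub_nonpos.2 (sigmoid_le h)) (sub_nonpos.2 h)
    · exact mul_nonneg (sub_nonneg.2 (sigmoid_le h)) (sub_nonneg.2 h)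
  rw [← abs_of_nonneg hmono, abs_mul, ← sq_abs]
  nlinarith [abs_nonneg (sigmoid x - sigmoid y)]

theorem sq_fFD_sub_le (β μ ν s t : ℝ) :
    (fFD β μ s - fFD β ν t) ^ 2 ≤
      -(β / 4) * ((fFD β μ s - fFD β ν t) * ((s - μ) - (t - ν))) := by
  have h (μ t : ℝ) : fFD β μ t = Real.sigmoid (-(β * (t - μ))) := by
    simp [fFD, Real.sigmoid_def]
  rw [h, h]
  exact (Real.sq_sigmoid_sub_le _ _).trans_eq (by ring)

/-- The Frobenius pairing of two differences of matrices diagonalised by `P` and `Q`. -/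
theorem trace_unitary_conj_sub_mul {n : ℕ} (P Q : Matrix.unitaryGroup (Fin n) ℝ)
    (x y x' y' : Fin n → ℝ) :
    (((P : Matrix (Fin n) (Fin n) ℝ) * diagonal x * star (P : Matrix (Fin n) (Fin n) ℝ) -
        (Q : Matrix (Fin n) (Fin n) ℝ) * diagonal y * star (Q : Matrix (Fin n) (Fin n) ℝ)) *
      ((P : Matrix (Fin n) (Fin n) ℝ) * diagonal x' * star (P : Matrix (Fin n) (Fin n) ℝ) -
        (Q : Matrix (Fin n) (Fin n) ℝ) * diagonal y' *
          star (Q : Matrix (Fin n) (Fin n) ℝ))ᴴ).trace =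
      ∑ i, ∑ j, (star (P : Matrix (Fin n) (Fin n) ℝ) * (Q : Matrix (Fin n) (Fin n) ℝ)) i j ^ 2 *
        ((x i - y j) * (x' i - y' j)) := by
  obtain ⟨P, hP⟩ := P
  obtain ⟨Q, hQ⟩ := Q
  have hP1 : star P * P = 1 := (Unitary.mem_iff.1 hP).1
  have hP2 : P * star P = 1 := (Unitary.mem_iff.1 hP).2
  have hQ1 : star Q * Q = 1 := (Unitary.mem_iff.1 hQ).1
  have hQ2 : Q * star Q = 1 := (Unitary.mem_iff.1 hQ).2
  have hfactor (x y : Fin n → ℝ) : P * diagonal x * star P - Q * diagonal y * star Q =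
      P * (diagonal x * (star P * Q) - (star P * Q) * diagonal y) * star Q := by
    calc _ = P * diagonal x * star P * (Q * star Q) -
          (P * star P) * Q * diagonal y * star Q := by simp [hP2, hQ2]
      _ = _ := by noncomm_ring
  dsimp only
  rw [hfactor, hfactor]
  generalize hM : diagonal x * (star P * Q) - (star P * Q) * diagonal y = M
  generalize hN : diagonal x' * (star P * Q) - (star P * Q) * diagonal y' = N
  have htrace : (P * M * star Q * (P * N * star Q)ᴴ).trace = (M * Nᴴ).trace := by
    have : P * M * star Q * (P * N * star Q)ᴴ = P * (M * Nᴴ * star P) := by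
      rw [conjTranspose_mul, conjTranspose_mul, ← star_eq_conjTranspose (star Q), star_star]
      calc _ = P * M * (star Q * Q) * (Nᴴ * Pᴴ) := by noncomm_ring
        _ = _ := by rw [hQ1, star_eq_conjTranspose]; noncomm_ring
    rw [this, trace_mul_comm, Matrix.mul_assoc, hP1, Matrix.mul_one]
  rw [htrace, ← hM, ← hN, trace]
  refine Finset.sum_congr rfl fun i _ => ?_
  rw [diag_apply, mul_apply]
  refine Finset.sum_congr rfl fun j _ => ?_
  simp only [conjTranspose_apply, Matrix.sub_apply, diagonal_mul, mul_diagonal, star_trivial]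
  ring

theorem matFun_sub_const {n : ℕ} {A : Matrix (Fin n) (Fin n) ℝ} (hA : A.IsHermitian) (μ : ℝ) :
    matFun (fun t => t - μ) A = A - μ • (1 : Matrix (Fin n) (Fin n) ℝ) := by
  have hU : (hA.eigenvectorUnitary : Matrix (Fin n) (Fin n) ℝ) *
      star (hA.eigenvectorUnitary : Matrix (Fin n) (Fin n) ℝ) = 1 :=
    (Unitary.mem_iff.1 hA.eigenvectorUnitary.2).2
  have hspec := hA.spectral_theorem
  rw [Unitary.conjStarAlgAut_apply] at hspec
  have hdiag : diagonal (fun k => hA.eigenvalues k - μ) =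
      diagonal (RCLike.ofReal ∘ hA.eigenvalues) - μ • (1 : Matrix (Fin n) (Fin n) ℝ) := by
    rw [smul_one_eq_diagonal, diagonal_sub]
    rfl
  rw [matFun, dif_pos hA, hdiag, Matrix.mul_sub, Matrix.sub_mul, ← hspec]
  simp [hU]

theorem trace_matFun {n : ℕ} {A : Matrix (Fin n) (Fin n) ℝ} (hA : A.IsHermitian) (φ : ℝ → ℝ) :
    (matFun φ A).trace = ∑ i, φ (eig A i) := by
  have hU : star (hA.eigenvectorUnitary : Matrix (Fin n) (Fin n) ℝ) *
      (hA.eigenvectorUnitary : Matrix (Fin n) (Fin n) ℝ) = 1 :=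
    (Unitary.mem_iff.1 hA.eigenvectorUnitary.2).1
  rw [matFun, dif_pos hA, eig, dif_pos hA, trace_mul_comm, ← Matrix.mul_assoc, hU,
    Matrix.one_mul, trace_diagonal]
  exact (Equiv.sum_comp (Tuple.sort hA.eigenvalues) fun k => φ (hA.eigenvalues k)).symm

/-- A pointwise cocoercivity inequality between `φ` and `ψ` lifts to their matrix functions. -/
theorem trace_matFun_sub_sq_le {n : ℕ} {A B : Matrix (Fin n) (Fin n) ℝ}
    (hA : A.IsHermitian) (hB : B.IsHermitian) {φ ψ φ' ψ' : ℝ → ℝ} {c : ℝ}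
    (h : ∀ s t, (φ s - ψ t) ^ 2 ≤ c * ((φ s - ψ t) * (φ' s - ψ' t))) :
    ((matFun φ A - matFun ψ B) * (matFun φ A - matFun ψ B)ᴴ).trace ≤
      c * ((matFun φ A - matFun ψ B) * (matFun φ' A - matFun ψ' B)ᴴ).trace := by
  simp only [matFun, dif_pos hA, dif_pos hB]
  rw [trace_unitary_conj_sub_mul, trace_unitary_conj_sub_mul, Finset.mul_sum]
  refine Finset.sum_le_sum fun i _ => ?_
  rw [Finset.mul_sum]
  refine Finset.sum_le_sum fun j _ => ?_
  rw [mul_left_comm c, ← pow_two (φ _ - ψ _)]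
  exact mul_le_mul_of_nonneg_left (h _ _) (sq_nonneg _)

theorem sum_sq_diag_le_trace {n : ℕ} (X : Matrix (Fin n) (Fin n) ℝ) :
    ∑ i, X i i ^ 2 ≤ (X * Xᴴ).trace := by
  refine Finset.sum_le_sum fun i _ => ?_
  rw [diag_apply, mul_apply]
  simp only [conjTranspose_apply, star_trivial, ← pow_two]
  exact Finset.single_le_sum (f := fun j => X i j ^ 2) (fun j _ => sq_nonneg _)
    (Finset.mem_univ i)

theorem isHermitian_Hmat {n : ℕ} {L Vion : Matrix (Fin n) (Fin n) ℝ}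
    (hL : L.IsHermitian) (hVion : Vion.IsHermitian) (V : Fin n → ℝ) :
    (Hmat L Vion V).IsHermitian :=
  ((hL.smul (IsSelfAdjoint.all _)).add hVion).add (isHermitian_diagonal V)

/-- The Fermi–Dirac density map at fixed particle number is `β / 4`-Lipschitz. -/
theorem vnorm_Ffd_sub_le {n : ℕ} {L Vion : Matrix (Fin n) (Fin n) ℝ}
    (hL : L.IsHermitian) (hVion : Vion.IsHermitian) {β c : ℝ} (hβ : 0 < β)
    {μf : (Fin n → ℝ) → ℝ}
    (hμf : ∀ W : Fin n → ℝ, ∑ i, fFD β (μf W) (eig (Hmat L Vion W) i) = c)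
    (V W : Fin n → ℝ) :
    vnorm (Ffd β μf L Vion V - Ffd β μf L Vion W) ≤ β / 4 * vnorm (V - W) := by
  have hA := isHermitian_Hmat hL hVion V
  have hB := isHermitian_Hmat hL hVion W
  have key := trace_matFun_sub_sq_le hA hB (sq_fFD_sub_le β (μf V) (μf W))
  rw [matFun_sub_const hA, matFun_sub_const hB] at key
  have htr : (matFun (fFD β (μf V)) (Hmat L Vion V) -
      matFun (fFD β (μf W)) (Hmat L Vion W)).trace = 0 := by
    rw [trace_sub, trace_matFun hA, trace_matFun hB, hμf, hμf, sub_self]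
  have hF : Ffd β μf L Vion V - Ffd β μf L Vion W =
      diag (matFun (fFD β (μf V)) (Hmat L Vion V) - matFun (fFD β (μf W)) (Hmat L Vion W)) := rfl
  have hdiff : (Hmat L Vion V - μf V • (1 : Matrix (Fin n) (Fin n) ℝ)) -
      (Hmat L Vion W - μf W • 1) = diagonal (V - W) - (μf V - μf W) • 1 := by
    have : diagonal (V - W) = diagonal V - diagonal W := (diagonal_sub V W).symm
    rw [this, Hmat, Hmat, sub_smul]
    abel
  rw [hF]
  generalize matFun (fFD β (μf V)) (Hmat L Vion V) - matFun (fFD β (μf W)) (Hmat L Vion W) = X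
    at key htr
  have hpair : (X * (diagonal (V - W) - (μf V - μf W) • 1)ᴴ).trace =
      ∑ i, diag X i * (V - W) i := by
    rw [conjTranspose_sub, conjTranspose_smul, conjTranspose_one, Matrix.mul_sub, trace_sub,
      Matrix.mul_smul, Matrix.mul_one, trace_smul, htr, smul_zero, sub_zero,
      diagonal_conjTranspose]
    exact Finset.sum_congr rfl fun i _ => by simp
  rw [hdiff, hpair] at key
  have hcs : -(∑ i, diag X i * (V - W) i) ≤ vnorm (diag X) * vnorm (V - W) := by
    have := Real.sum_mul_le_sqrt_mul_sqrt Finset.univ (fun i => -diag X i) (V - W)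
    simpa [vnorm] using this
  have hsq : vnorm (diag X) * vnorm (diag X) ≤ β / 4 * vnorm (V - W) * vnorm (diag X) := by
    have := sum_sq_diag_le_trace X
    have h2 := vnorm_sq (diag X)
    simp only [diag_apply] at h2 hcs key ⊢
    nlinarith
  rcases (vnorm_nonneg (diag X)).eq_or_lt with h0 | h0
  · rw [← h0]
    exact mul_nonneg (by positivity) (vnorm_nonneg _)
  · exact le_of_mul_le_mul_right hsq h0

/-- The contraction mapping principle for the damped iteration of a Lipschitz map in the
Euclidean norm. -/
theorem exists_fixedPoint_of_vnorm_sub_le {n : ℕ} {G : (Fin n → ℝ) → (Fin n → ℝ)} {q α : ℝ}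
    (hq : 0 ≤ q) (hG : ∀ x y, vnorm (G x - G y) ≤ q * vnorm (x - y))
    (hα : 0 < α) (hK : |1 - α| + α * q < 1) {V : ℕ → Fin n → ℝ}
    (hV : ∀ i, V (i + 1) = V i - α • (V i - G (V i))) :
    ∃ x, x = G x ∧ Tendsto V atTop (nhds x) ∧
      ∀ i, vnorm (V (i + 1) - x) ≤ (|1 - α| + α * q) * vnorm (V i - x) := by
  let T : EuclideanSpace ℝ (Fin n) → EuclideanSpace ℝ (Fin n) := fun u =>
    WithLp.toLp 2 (u.ofLp - α • (u.ofLp - G u.ofLp))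
  have hK0 : 0 ≤ |1 - α| + α * q := by positivity
  have hT (u w : EuclideanSpace ℝ (Fin n)) :
      dist (T u) (T w) ≤ (|1 - α| + α * q) * dist u w := by
    have hG' := hG u.ofLp w.ofLp
    rw [vnorm_eq_norm, vnorm_eq_norm] at hG'
    have hdecomp : T u - T w = (1 - α) • (u - w) +
        α • WithLp.toLp 2 (G u.ofLp - G w.ofLp) := by
      ext i
      simp [T]
      ring
    rw [dist_eq_norm, dist_eq_norm, hdecomp]
    refine (norm_add_le _ _).trans ?_
    rw [norm_smul, norm_smul, Real.norm_eq_abs, Real.norm_eq_abs, abs_of_pos hα, add_mul,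
      mul_assoc α]
    gcongr
    exact hG'
  have hc : ContractingWith ⟨|1 - α| + α * q, hK0⟩ T :=
    ⟨by exact_mod_cast hK, LipschitzWith.of_dist_le_mul hT⟩
  have hiter (i : ℕ) : T^[i] (WithLp.toLp 2 (V 0)) = WithLp.toLp 2 (V i) := by
    induction i with
    | zero => rfl
    | succ i ih => rw [Function.iterate_succ_apply', ih, hV]
  have hfix : T (hc.fixedPoint T) = hc.fixedPoint T := hc.fixedPoint_isFixedPt
  have hlim := hc.tendsto_iterate_fixedPoint (WithLp.toLp 2 (V 0))
  simp only [hiter] at hlim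
  generalize hc.fixedPoint T = x at hfix hlim
  refine ⟨x.ofLp, ?_, ?_, fun i => ?_⟩
  · have h : x.ofLp - α • (x.ofLp - G x.ofLp) = x.ofLp := congrArg WithLp.ofLp hfix
    rw [sub_eq_self, smul_eq_zero, sub_eq_zero] at h
    exact h.resolve_left hα.ne'
  · exact ((EuclideanSpace.equiv (Fin n) ℝ).continuous.tendsto x).comp hlim
  · have h := hT (WithLp.toLp 2 (V i)) x
    rw [hfix, dist_eq_norm, dist_eq_norm] at h
    rw [vnorm_eq_norm, vnorm_eq_norm, hV]
    exact h

/-- Theorem 4.4 of the paper: global convergence of the SCF iteration with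
simple mixing for the Fermi–Dirac smoothed fixed point map. -/
theorem scf_simple_mixing_global_FD {n p : ℕ} (hp : 1 ≤ p) (hpn : p < n)
    (L Vion Ld : Matrix (Fin n) (Fin n) ℝ)
    (hL : L.IsHermitian) (hVion : Vion.IsHermitian)
    (hMP1 : L * Ld * L = L) (hMP2 : Ld * L * Ld = Ld)
    (hMP3 : (L * Ld)ᵀ = L * Ld) (hMP4 : (Ld * L)ᵀ = Ld * L)
    (m : (Fin n → ℝ) → (Fin n → ℝ)) (θ : ℝ)
    (hm1 : ContDiff ℝ 1 m)
    (hmθ : ∀ (ρ : Fin n → ℝ) (z : Fin n → ℝ), vnorm (fderiv ℝ m ρ z) ≤ θ * vnorm z)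
    (β : ℝ) (hβ : 0 < β)
    (μf : (Fin n → ℝ) → ℝ)
    (hμf : ∀ W : Fin n → ℝ, ∑ i, fFD β (μf W) (eig (Hmat L Vion W) i) = p)
    (b2 : ℝ) (hb2def : b2 = 1 - β * (specNorm Ld + θ) / 4) (hb2 : 0 < b2)
    (α : ℝ) (hα0 : 0 < α) (hα : α < 2 / (2 - b2))
    (V : ℕ → Fin n → ℝ)
    (hiter : ∀ i, V (i + 1) = V i - α • (V i - potMap Ld m (Ffd β μf L Vion (V i)))) :
    ∃ Vstar : Fin n → ℝ,
      Vstar = potMap Ld m (Ffd β μf L Vion Vstar) ∧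
      Filter.Tendsto V Filter.atTop (nhds Vstar) ∧
      ∀ i, vnorm (V (i + 1) - Vstar) ≤ (|1 - α| + α * (1 - b2)) * vnorm (V i - Vstar) := by
  have hn : 0 < n := (Nat.zero_le p).trans_lt hpn
  have hθ : 0 ≤ θ := by
    have h := (vnorm_nonneg _).trans (hmθ 0 (Pi.single ⟨0, hn⟩ 1))
    have hunit : vnorm (Pi.single (⟨0, hn⟩ : Fin n) (1 : ℝ) : Fin n → ℝ) = 1 := by
      simp [vnorm_eq_norm]
    rwa [hunit, mul_one] at h
  have hLd : 0 ≤ specNorm Ld := norm_nonneg _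
  have hq : 1 - b2 = (specNorm Ld + θ) * (β / 4) := by rw [hb2def]; ring
  have hq0 : 0 ≤ 1 - b2 := hq ▸ by positivity
  have hG (x y : Fin n → ℝ) :
      vnorm (potMap Ld m (Ffd β μf L Vion x) - potMap Ld m (Ffd β μf L Vion y)) ≤
        (1 - b2) * vnorm (x - y) := by
    have hF := vnorm_Ffd_sub_le hL hVion hβ hμf x y
    generalize Ffd β μf L Vion x = ρ at hF ⊢
    generalize Ffd β μf L Vion y = σ at hF ⊢
    have hsplit : potMap Ld m ρ - potMap Ld m σ = Ld *ᵥ (ρ - σ) + (m ρ - m σ) := by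
      rw [potMap, potMap, mulVec_sub]
      abel
    calc vnorm (potMap Ld m ρ - potMap Ld m σ)
        ≤ vnorm (Ld *ᵥ (ρ - σ)) + vnorm (m ρ - m σ) := by
          rw [hsplit, vnorm_eq_norm, vnorm_eq_norm, vnorm_eq_norm, WithLp.toLp_add]
          exact norm_add_le _ _
      _ ≤ specNorm Ld * vnorm (ρ - σ) + θ * vnorm (ρ - σ) :=
          add_le_add (vnorm_mulVec_le _ _)
            (vnorm_sub_le_of_vnorm_fderiv_le hθ (hm1.differentiable one_ne_zero) hmθ _ _)
      _ = (specNorm Ld + θ) * vnorm (ρ - σ) := by ring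
      _ ≤ (specNorm Ld + θ) * (β / 4 * vnorm (x - y)) := by gcongr
      _ = (1 - b2) * vnorm (x - y) := by rw [hq]; ring
  have hK : |1 - α| + α * (1 - b2) < 1 := by
    rw [lt_div_iff₀ (by linarith)] at hα
    rcases abs_cases (1 - α) with ⟨h, _⟩ | ⟨h, _⟩ <;> rw [h] <;> nlinarith
  exact exists_fixedPoint_of_vnorm_sub_le hq0 hG hα0 hK hiter
end

section
/- Let M ∈ ℝ^{n×n} be symmetric and P ∈ ℝ^{n×n} be symmetric positive semidefinite. Then all eigenvalues of the matrix MP are real. Moreover, writing λ_max and λ_min for the largest and smallest (real) eigenvalues: λ_max(MP) ≤ λ_max(M)λ_max(P) if λ_max(M) ≥ 0, and λ_max(MP) ≤ λ_max(M)λ_min(P) otherwise; and λ_min(MP) ≥ λ_min(M)λ_min(P) if λ_min(M) ≥ 0, and λ_min(MP) ≥ λ_min(M)λ_max(P) otherwise. -/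
open Matrix

/-- Smallest real element of the spectrum. -/
noncomputable def lamMin {n : ℕ} (A : Matrix (Fin n) (Fin n) ℝ) : ℝ := sInf (spectrum ℝ A)

/-- Largest real element of the spectrum. -/
noncomputable def lamMax {n : ℕ} (A : Matrix (Fin n) (Fin n) ℝ) : ℝ := sSup (spectrum ℝ A)

open scoped MatrixOrder

lemma Matrix.spectrum_mul_comm {ι K : Type*} [Fintype ι] [DecidableEq ι] [Field K]
    (A B : Matrix ι ι K) : spectrum K (A * B) = spectrum K (B * A) := by
  ext r
  rw [mem_spectrum_iff_isRoot_charpoly, mem_spectrum_iff_isRoot_charpoly, charpoly_mul_comm]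

lemma Matrix.IsHermitian.im_eq_zero_of_mem_spectrum {ι : Type*} [Fintype ι] [DecidableEq ι]
    {A : Matrix ι ι ℂ} (hA : A.IsHermitian) {μ : ℂ} (hμ : μ ∈ spectrum ℂ A) : μ.im = 0 := by
  rw [hA.spectrum_eq_image_range] at hμ
  obtain ⟨r, -, rfl⟩ := hμ
  exact Complex.ofReal_im r

lemma Matrix.PosSemidef.exists_isHermitian_mul_self {ι : Type*} [Fintype ι] [DecidableEq ι]
    {P : Matrix ι ι ℝ} (hP : P.PosSemidef) : ∃ S : Matrix ι ι ℝ, S.IsHermitian ∧ S * S = P :=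
  ⟨CFC.sqrt P, (CFC.sqrt_nonneg P).isSelfAdjoint, CFC.sqrt_mul_sqrt_self P hP.nonneg⟩

section

variable {n : ℕ} {A M S : Matrix (Fin n) (Fin n) ℝ}

lemma Matrix.IsHermitian.le_lamMax (hA : A.IsHermitian) : A ≤ algebraMap ℝ _ (lamMax A) :=
  le_algebraMap_of_spectrum_le (fun _ hx => le_csSup finite_real_spectrum.bddAbove hx) hA

lemma Matrix.IsHermitian.lamMin_le (hA : A.IsHermitian) : algebraMap ℝ _ (lamMin A) ≤ A :=
  algebraMap_le_of_le_spectrum (fun _ hx => csInf_le finite_real_spectrum.bddBelow hx) hA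

lemma Matrix.IsHermitian.spectrum_nonempty (hn : 0 < n) (hA : A.IsHermitian) :
    (spectrum ℝ A).Nonempty :=
  ⟨_, hA.eigenvalues_mem_spectrum_real ⟨0, hn⟩⟩

lemma Matrix.IsHermitian.lamMax_le (hn : 0 < n) (hA : A.IsHermitian) {c : ℝ}
    (h : A ≤ algebraMap ℝ _ c) : lamMax A ≤ c :=
  csSup_le (hA.spectrum_nonempty hn) ((le_algebraMap_iff_spectrum_le hA).1 h)

lemma Matrix.IsHermitian.le_lamMin (hn : 0 < n) (hA : A.IsHermitian) {c : ℝ}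
    (h : algebraMap ℝ _ c ≤ A) : c ≤ lamMin A :=
  le_csInf (hA.spectrum_nonempty hn) ((algebraMap_le_iff_le_spectrum hA).1 h)

lemma Matrix.IsHermitian.mul_mul_self (hS : S.IsHermitian) (hM : M.IsHermitian) :
    (S * M * S).IsHermitian := by
  simpa only [hS.eq] using isHermitian_mul_mul_conjTranspose S hM

lemma Matrix.mul_algebraMap_mul_self (S : Matrix (Fin n) (Fin n) ℝ) (a : ℝ) :
    S * algebraMap ℝ _ a * S = a • (S * S) := by
  simp [Algebra.algebraMap_eq_smul_one]

lemma Matrix.smul_algebraMap (a b : ℝ) :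
    a • algebraMap ℝ (Matrix (Fin n) (Fin n) ℝ) b = algebraMap ℝ _ (a * b) := by
  rw [map_mul, Algebra.smul_def]

lemma lamMax_mul_self_le (hn : 0 < n) (hM : M.IsHermitian) (hS : S.IsHermitian) :
    lamMax (S * M * S) ≤ if 0 ≤ lamMax M then lamMax M * lamMax (S * S)
      else lamMax M * lamMin (S * S) := by
  have hSS : (S * S).IsHermitian := by simpa using hS.mul_mul_self isHermitian_one
  have h : S * M * S ≤ lamMax M • (S * S) := by
    rw [← mul_algebraMap_mul_self]
    exact IsSelfAdjoint.conjugate_le_conjugate hM.le_lamMax hS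
  refine (hS.mul_mul_self hM).lamMax_le hn (h.trans ?_)
  split_ifs with h0
  · rw [← smul_algebraMap]
    exact smul_le_smul_of_nonneg_left hSS.le_lamMax h0
  · rw [← smul_algebraMap]
    exact smul_le_smul_of_nonpos_left hSS.lamMin_le (not_le.1 h0).le

lemma le_lamMin_mul_self (hn : 0 < n) (hM : M.IsHermitian) (hS : S.IsHermitian) :
    (if 0 ≤ lamMin M then lamMin M * lamMin (S * S) else lamMin M * lamMax (S * S)) ≤
      lamMin (S * M * S) := by
  have hSS : (S * S).IsHermitian := by simpa using hS.mul_mul_self isHermitian_one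
  have h : lamMin M • (S * S) ≤ S * M * S := by
    rw [← mul_algebraMap_mul_self]
    exact IsSelfAdjoint.conjugate_le_conjugate hM.lamMin_le hS
  refine (hS.mul_mul_self hM).le_lamMin hn (le_trans ?_ h)
  split_ifs with h0
  · rw [← smul_algebraMap]
    exact smul_le_smul_of_nonneg_left hSS.lamMin_le h0
  · rw [← smul_algebraMap]
    exact smul_le_smul_of_nonpos_left hSS.le_lamMax (not_le.1 h0).le

end

/-- Lemma 4.6 of the paper: if `M` is symmetric and `P` is symmetric
positive semidefinite, then all eigenvalues of `MP` are real, and the largest and smallest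
eigenvalues of `MP` obey the stated product bounds. -/
theorem eigenvalues_product_sym_psd {n : ℕ} (hn : 0 < n)
    (M P : Matrix (Fin n) (Fin n) ℝ) (hM : M.IsHermitian) (hP : P.PosSemidef) :
    (∀ μ ∈ spectrum ℂ ((M * P).map (algebraMap ℝ ℂ)), μ.im = 0) ∧
    lamMax (M * P) ≤
      (if 0 ≤ lamMax M then lamMax M * lamMax P else lamMax M * lamMin P) ∧
    (if 0 ≤ lamMin M then lamMin M * lamMin P else lamMin M * lamMax P) ≤
      lamMin (M * P) := by
  obtain ⟨S, hS, rfl⟩ := hP.exists_isHermitian_mul_self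
  have hspec : spectrum ℝ (M * (S * S)) = spectrum ℝ (S * M * S) := by
    rw [← mul_assoc, spectrum_mul_comm, ← mul_assoc]
  refine ⟨fun μ hμ => ?_, ?_, ?_⟩
  · rw [← mul_assoc, Matrix.map_mul, spectrum_mul_comm, ← Matrix.map_mul, ← mul_assoc] at hμ
    exact ((hS.mul_mul_self hM).map _
      fun x => (Complex.conj_ofReal x).symm).im_eq_zero_of_mem_spectrum hμ
  · rw [lamMax, hspec]
    exact lamMax_mul_self_le hn hM hS
  · rw [lamMin.eq_def (M * (S * S)), hspec]
    exact le_lamMin_mul_self hn hM hS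
end
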